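/- arXiv:1803.00856 — 5 statements merged into one kernel-verified Lean document; each statement's English description precedes it below -/
import Mathlib

section
/- Let K : H² → ℝ be continuous with |K(z)| ≤ 1 for every z ∈ H². Then no K-loop exists; that is, there is no nonconstant C² 2π-periodic curve u : ℝ → H² solving u'' − u₂⁻¹Γ(u') = L(u)K(u) iu'. -/
open Real MeasureTheory Filter Topology

noncomputable section

/-- Rotation by π/2 in the plane: `iw = (-w₂, w₁)`. -/
def rot (w : ℝ × ℝ) : ℝ × ℝ := (-w.2, w.1)

/-- The Christoffel-type term `Γ(w) = (2w₁w₂, w₂² - w₁²)`. -/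
def Gam (w : ℝ × ℝ) : ℝ × ℝ := (2 * w.1 * w.2, w.2 ^ 2 - w.1 ^ 2)

/-- Euclidean dot product in ℝ². -/
def dotp (v w : ℝ × ℝ) : ℝ := v.1 * w.1 + v.2 * w.2

/-- The hyperbolic length-type functional `L(u) = ((1/2π)∫₀^{2π} u₂⁻²|u'|² dt)^{1/2}`. -/
def hypL (u : ℝ → ℝ × ℝ) : ℝ :=
  Real.sqrt ((1 / (2 * π)) * ∫ t in (0:ℝ)..(2 * π),
    ((deriv u t).1 ^ 2 + (deriv u t).2 ^ 2) / (u t).2 ^ 2)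

/-- `u` is a `K`-loop in the upper half-plane model of the hyperbolic plane:
a nonconstant C² `2π`-periodic curve with values in `H²` solving
`u'' - u₂⁻¹ Γ(u') = L(u) K(u) iu'`. -/
def IsKLoop (K : (ℝ × ℝ) → ℝ) (u : ℝ → ℝ × ℝ) : Prop :=
  ContDiff ℝ 2 u ∧ Function.Periodic u (2 * π) ∧ (∀ t, 0 < (u t).2) ∧
  (¬ ∃ c, ∀ t, u t = c) ∧
  ∀ t, deriv (deriv u) t - ((u t).2)⁻¹ • Gam (deriv u t)
      = (hypL u * K (u t)) • rot (deriv u t)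

/-- A `2π`-periodic curve is embedded if it is injective modulo `2π`. -/
def IsEmbedded (u : ℝ → ℝ × ℝ) : Prop :=
  ∀ t s : ℝ, u t = u s → ∃ n : ℤ, t - s = 2 * π * (n : ℝ)

/-- A curve with constant hyperbolic speed `c ≥ 0` has `L(u) = c`. -/
lemma hypL_eq_of_speed_sq {u : ℝ → ℝ × ℝ} {c : ℝ} (hc : 0 ≤ c)
    (h : ∀ t, ((deriv u t).1 ^ 2 + (deriv u t).2 ^ 2) / (u t).2 ^ 2 = c ^ 2) : hypL u = c := by
  unfold hypL
  simp only [h, intervalIntegral.integral_const, sub_zero, smul_eq_mul]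
  rw [← mul_assoc, one_div_mul_cancel (by positivity), one_mul, Real.sqrt_sq hc]

/-- Let `F = (x² + y² + 1) / (2y)`, the hyperbolic cosine of the distance to `(0, 1)`. Along a curve
of hyperbolic speed `L > 0` and curvature `k ∈ [-1, 1]` the second derivative of `F` is positive. -/
lemma second_deriv_cosh_dist_pos {x y p q L k : ℝ} (hy : 0 < y) (hL : 0 < L)
    (hk : |k| ≤ 1) (hs : p ^ 2 + q ^ 2 = L ^ 2 * y ^ 2) :
    0 < L ^ 2 * ((x ^ 2 + y ^ 2 + 1) / (2 * y))
      + L * k * (p * (y ^ 2 - x ^ 2 - 1) / (2 * y ^ 2) - x * q / y) := by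
  set A := x ^ 2 + y ^ 2 + 1 with hA
  set T := p * (y ^ 2 - x ^ 2 - 1) - 2 * x * y * q with hT
  have hApos : 0 < A := by positivity
  have hT_sq : T ^ 2 < (L * y * A) ^ 2 := by
    have h1 : T ^ 2 + (q * (y ^ 2 - x ^ 2 - 1) + 2 * x * y * p) ^ 2
        = (L * y) ^ 2 * (A ^ 2 - 4 * y ^ 2) := by
      have : (L * y) ^ 2 = p ^ 2 + q ^ 2 := by rw [hs]; ring
      rw [this, hT, hA]; ring
    have h2 : 0 < (L * y) ^ 2 * (4 * y ^ 2) := by positivity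
    nlinarith [sq_nonneg (q * (y ^ 2 - x ^ 2 - 1) + 2 * x * y * p)]
  have hT_abs : |T| < L * y * A := abs_lt_of_sq_lt_sq hT_sq (by positivity)
  have hkT : |k * T| < L * y * A := by
    rw [abs_mul]
    exact (mul_le_of_le_one_left (abs_nonneg T) hk).trans_lt hT_abs
  have hsum : 0 < L * y * A + k * T := by linarith [(abs_lt.mp hkT).1]
  have heq : L ^ 2 * (A / (2 * y))
      + L * k * (p * (y ^ 2 - x ^ 2 - 1) / (2 * y ^ 2) - x * q / y)
      = L / (2 * y ^ 2) * (L * y * A + k * T) := by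
    rw [hT]; field_simp
  rw [heq]
  positivity

/-- if `|K| ≤ 1` on the hyperbolic plane, no `K`-loop exists. -/
theorem stmt_0 (K : (ℝ × ℝ) → ℝ)
    (hK : ContinuousOn K {z : ℝ × ℝ | 0 < z.2})
    (hb : ∀ z : ℝ × ℝ, 0 < z.2 → |K z| ≤ 1) :
    ¬ ∃ u : ℝ → ℝ × ℝ, IsKLoop K u := by
  rintro ⟨u, hu, hper, hpos, hnc, hode⟩
  have hdiff : Differentiable ℝ u := hu.differentiable (by norm_num)
  have hdiff' : Differentiable ℝ (deriv u) :=
    (ContDiff.deriv' (n := 1) hu).differentiable (by norm_num)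
  have hx (t) : HasDerivAt (fun s => (u s).1) (deriv u t).1 t := (hdiff t).hasDerivAt.fst
  have hy (t) : HasDerivAt (fun s => (u s).2) (deriv u t).2 t := (hdiff t).hasDerivAt.snd
  have hp (t) : HasDerivAt (fun s => (deriv u s).1) (2 * (deriv u t).1 * (deriv u t).2 / (u t).2
      - hypL u * K (u t) * (deriv u t).2) t := by
    refine HasDerivAt.congr_deriv (hdiff' t).hasDerivAt.fst ?_
    change (deriv (deriv u) t).1 = _
    have := congrArg Prod.fst (hode t)
    simp only [Gam, rot, Prod.fst_sub, Prod.smul_fst, smul_eq_mul] at this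
    rw [sub_eq_iff_eq_add.mp this]; ring
  have hq (t) : HasDerivAt (fun s => (deriv u s).2)
      (((deriv u t).2 ^ 2 - (deriv u t).1 ^ 2) / (u t).2 + hypL u * K (u t) * (deriv u t).1) t := by
    refine HasDerivAt.congr_deriv (hdiff' t).hasDerivAt.snd ?_
    change (deriv (deriv u) t).2 = _
    have := congrArg Prod.snd (hode t)
    simp only [Gam, rot, Prod.snd_sub, Prod.smul_snd, smul_eq_mul] at this
    rw [sub_eq_iff_eq_add.mp this]; ring
  have hspeed (t) : HasDerivAt
      (fun s => ((deriv u s).1 ^ 2 + (deriv u s).2 ^ 2) / (u s).2 ^ 2) 0 t := by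
    have hne := (hpos t).ne'
    refine ((((hp t).pow 2).add ((hq t).pow 2)).div ((hy t).pow 2)
      (pow_ne_zero 2 hne)).congr_deriv ?_
    simp only [Pi.add_apply, Pi.pow_apply, Nat.cast_ofNat, Nat.add_one_sub_one, pow_one]
    field_simp
    ring
  obtain ⟨c, hc, hspeed_eq⟩ : ∃ c : ℝ, 0 ≤ c ∧
      ∀ t, ((deriv u t).1 ^ 2 + (deriv u t).2 ^ 2) / (u t).2 ^ 2 = c ^ 2 := by
    refine ⟨√(((deriv u 0).1 ^ 2 + (deriv u 0).2 ^ 2) / (u 0).2 ^ 2), Real.sqrt_nonneg _,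
      fun t => ?_⟩
    rw [Real.sq_sqrt (by positivity)]
    exact is_const_of_deriv_eq_zero (fun s => (hspeed s).differentiableAt)
      (fun s => (hspeed s).deriv) t 0
  have hL := hypL_eq_of_speed_sq hc hspeed_eq
  have hspeed_sq (t) : (deriv u t).1 ^ 2 + (deriv u t).2 ^ 2 = c ^ 2 * (u t).2 ^ 2 :=
    (div_eq_iff (pow_ne_zero 2 (hpos t).ne')).mp (hspeed_eq t)
  have hcpos : 0 < c := by
    refine hc.lt_of_ne fun h0 => hnc ⟨u 0, fun t => ?_⟩
    refine is_const_of_deriv_eq_zero hdiff (fun s => ?_) t 0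
    have := hspeed_sq s
    rw [← h0] at this
    ext
    · simp only [Prod.fst_zero]; nlinarith
    · simp only [Prod.snd_zero]; nlinarith
  -- `G` is the derivative of `(x² + y² + 1) / (2y)` along the curve.
  set G : ℝ → ℝ := fun s => (u s).1 * (deriv u s).1 / (u s).2
    + (deriv u s).2 * (1 - ((u s).1 ^ 2 + 1) / (u s).2 ^ 2) / 2 with hG
  have hGderiv (t) : HasDerivAt G (c ^ 2 * (((u t).1 ^ 2 + (u t).2 ^ 2 + 1) / (2 * (u t).2))
      + c * K (u t) * ((deriv u t).1 * ((u t).2 ^ 2 - (u t).1 ^ 2 - 1) / (2 * (u t).2 ^ 2)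
        - (u t).1 * (deriv u t).2 / (u t).2)) t := by
    have hne := (hpos t).ne'
    refine ((((hx t).mul (hp t)).div (hy t) hne).add (((hq t).mul
      (((((hx t).pow 2).add_const 1).div ((hy t).pow 2) (pow_ne_zero 2 hne)).const_sub 1)).div_const
        2)).congr_deriv ?_
    have hc2 : c ^ 2 = ((deriv u t).1 ^ 2 + (deriv u t).2 ^ 2) / (u t).2 ^ 2 :=
      (hspeed_eq t).symm
    rw [hL, hc2]
    simp only [Pi.mul_apply, Pi.div_apply, Pi.pow_apply, Nat.cast_ofNat, Nat.add_one_sub_one,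
      pow_one]
    field_simp
    ring
  have hmono : StrictMono G := strictMono_of_hasDerivAt_pos hGderiv fun t =>
    second_deriv_cosh_dist_pos (hpos t) hcpos (hb _ (hpos t)) (hspeed_sq t)
  have hu_end : u (2 * π) = u 0 := by simpa using hper 0
  have hdu_end : deriv u (2 * π) = deriv u 0 := by
    have h := deriv_comp_add_const u (2 * π) 0
    rw [zero_add, show (fun s => u (s + 2 * π)) = u from funext hper] at h
    exact h.symm
  have hG_end : G (2 * π) = G 0 := by simp only [hG, hu_end, hdu_end]
  exact (hmono Real.two_pi_pos).ne hG_end.symm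
end
end

section
/- Let K be of class C¹ on H² and let Ω ⊂ H² be a bounded open domain whose boundary is parameterized by a K-loop; that is, there is a K-loop u which is embedded and whose image u(ℝ) equals the topological boundary ∂Ω. Then ∫_Ω ∂₁K(z) z₂⁻² dz = 0, ∫_Ω (∇K(z)·z) z₂⁻² dz = 0, and ∫_Ω (∇K(z)·(z₁²−z₂², 2z₁z₂)) z₂⁻² dz = 0 (Lebesgue integrals over Ω ⊂ ℝ²). -/
open Real MeasureTheory Filter Topology

noncomputable section

/-- The determinant of two plane vectors. -/
def cross (v w : ℝ × ℝ) : ℝ := v.1 * w.2 - v.2 * w.1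

/-- The divergence of a plane vector field. -/
def divergence (G : ℝ × ℝ → ℝ × ℝ) (z : ℝ × ℝ) : ℝ :=
  (fderiv ℝ G z (1, 0)).1 + (fderiv ℝ G z (0, 1)).2

/-- The map `(t, s) ↦ u t + s n t` sweeping a strip around the curve `u` in the direction `n`. -/
def tube (u n : ℝ → ℝ × ℝ) (p : ℝ × ℝ) : ℝ × ℝ := u p.1 + p.2 • n p.1

/-- The derivative of `tube u n`. -/
def tubeDeriv (u n : ℝ → ℝ × ℝ) (p : ℝ × ℝ) : ℝ × ℝ →L[ℝ] ℝ × ℝ :=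
  (ContinuousLinearMap.fst ℝ ℝ ℝ).smulRight (deriv u p.1 + p.2 • deriv n p.1) +
    (ContinuousLinearMap.snd ℝ ℝ ℝ).smulRight (n p.1)

theorem cross_apply_add_cross_apply (M : ℝ × ℝ →L[ℝ] ℝ × ℝ) (a b : ℝ × ℝ) :
    cross (M a) b + cross a (M b) = ((M (1, 0)).1 + (M (0, 1)).2) * cross a b := by
  have h : ∀ c : ℝ × ℝ, M c = c.1 • M (1, 0) + c.2 • M (0, 1) := fun c => by
    rw [← map_smul, ← map_smul, ← map_add]; simp
  rw [h a, h b]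
  simp only [cross, Prod.fst_add, Prod.snd_add, Prod.smul_fst, Prod.smul_snd, smul_eq_mul]
  ring

theorem HasDerivAt.fst_comp {f : ℝ → ℝ × ℝ} {f' : ℝ × ℝ} {t : ℝ} (h : HasDerivAt f f' t) :
    HasDerivAt (fun x => (f x).1) f'.1 t := by
  simpa using (HasFDerivAt.fst h.hasFDerivAt).hasDerivAt

theorem HasDerivAt.snd_comp {f : ℝ → ℝ × ℝ} {f' : ℝ × ℝ} {t : ℝ} (h : HasDerivAt f f' t) :
    HasDerivAt (fun x => (f x).2) f'.2 t := by
  simpa using (HasFDerivAt.snd h.hasFDerivAt).hasDerivAt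

theorem hasDerivAt_cross {f g : ℝ → ℝ × ℝ} {f' g' : ℝ × ℝ} {t : ℝ}
    (hf : HasDerivAt f f' t) (hg : HasDerivAt g g' t) :
    HasDerivAt (fun x => cross (f x) (g x)) (cross f' (g t) + cross (f t) g') t := by
  refine ((hf.fst_comp.mul hg.snd_comp).sub (hf.snd_comp.mul hg.fst_comp)).congr_deriv ?_
  simp only [cross]; ring

theorem continuous_cross {X : Type*} [TopologicalSpace X] {f g : X → ℝ × ℝ}
    (hf : Continuous f) (hg : Continuous g) : Continuous fun x => cross (f x) (g x) := by
  unfold cross; fun_prop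

theorem continuous_divergence {G : ℝ × ℝ → ℝ × ℝ} (hG : ContDiff ℝ 1 G) :
    Continuous (divergence G) := by
  have := hG.continuous_fderiv one_ne_zero
  unfold divergence; fun_prop

theorem hasCompactSupport_divergence {G : ℝ × ℝ → ℝ × ℝ} (hG : HasCompactSupport G) :
    HasCompactSupport (divergence G) :=
  (hG.fderiv (𝕜 := ℝ)).comp_left
    (g := fun M : ℝ × ℝ →L[ℝ] ℝ × ℝ => (M (1, 0)).1 + (M (0, 1)).2) (by simp)

theorem integral_fderiv_apply_eq_zero {E : Type*} [NormedAddCommGroup E] [NormedSpace ℝ E]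
    [CompleteSpace E] {g : ℝ × ℝ → E} (hg : ContDiff ℝ 1 g)
    (hs : HasCompactSupport g) (v : ℝ × ℝ) : ∫ z, fderiv ℝ g z v = 0 := by
  have hc := hg.continuous_fderiv one_ne_zero
  have hi : Integrable fun z => fderiv ℝ g z v :=
    (show Continuous fun z => fderiv ℝ g z v by fun_prop).integrable_of_hasCompactSupport
      ((hs.fderiv (𝕜 := ℝ)).comp_left (g := fun M : ℝ × ℝ →L[ℝ] E => M v) (by simp))
  have := integral_smul_fderiv_eq_neg_fderiv_smul_of_integrable (μ := volume)
    (f := fun _ : ℝ × ℝ => (1 : ℝ)) (g := g) (v := v) (by simp) (by simpa using hi)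
    (by simpa using hg.continuous.integrable_of_hasCompactSupport hs)
    (fun x _ => by fun_prop) (fun x _ => hg.differentiable one_ne_zero x)
  simpa using this

theorem integral_divergence_eq_zero {G : ℝ × ℝ → ℝ × ℝ} (hG : ContDiff ℝ 1 G)
    (hs : HasCompactSupport G) : ∫ z, divergence G z = 0 := by
  have hc := hG.continuous_fderiv one_ne_zero
  have hi : ∀ v, Integrable fun z => fderiv ℝ G z v := fun v =>
    (show Continuous fun z => fderiv ℝ G z v by fun_prop).integrable_of_hasCompactSupport
      ((hs.fderiv (𝕜 := ℝ)).comp_left (g := fun M : ℝ × ℝ →L[ℝ] ℝ × ℝ => M v) (by simp))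
  unfold divergence
  rw [integral_add (hi _).fst (hi _).snd, ← fst_integral (hi _), ← snd_integral (hi _),
    integral_fderiv_apply_eq_zero hG hs, integral_fderiv_apply_eq_zero hG hs]
  simp

section Tube

variable {u n : ℝ → ℝ × ℝ}

theorem contDiff_tube (hu : ContDiff ℝ 1 u) (hn : ContDiff ℝ 1 n) : ContDiff ℝ 1 (tube u n) := by
  unfold tube; fun_prop

theorem hasFDerivAt_tube (hu : ContDiff ℝ 1 u) (hn : ContDiff ℝ 1 n) (p : ℝ × ℝ) :
    HasFDerivAt (tube u n) (tubeDeriv u n p) p := by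
  have h1 : HasFDerivAt (fun p : ℝ × ℝ => u p.1) _ p :=
    (hu.differentiable one_ne_zero p.1).hasDerivAt.hasFDerivAt.comp p hasFDerivAt_fst
  have h2 : HasFDerivAt (fun p : ℝ × ℝ => n p.1) _ p :=
    (hn.differentiable one_ne_zero p.1).hasDerivAt.hasFDerivAt.comp p hasFDerivAt_fst
  have h3 : HasFDerivAt (fun p : ℝ × ℝ => p.2) _ p := hasFDerivAt_snd (𝕜 := ℝ)
  refine (h1.add (h3.smul h2)).congr_fderiv ?_
  ext <;> simp [tubeDeriv]

theorem hasStrictFDerivAt_tube (hu : ContDiff ℝ 1 u) (hn : ContDiff ℝ 1 n) (p : ℝ × ℝ) :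
    HasStrictFDerivAt (tube u n) (tubeDeriv u n p) p :=
  (contDiff_tube hu hn).contDiffAt.hasStrictFDerivAt' (hasFDerivAt_tube hu hn p) one_ne_zero

theorem det_tubeDeriv (u n : ℝ → ℝ × ℝ) (p : ℝ × ℝ) :
    (tubeDeriv u n p).det = cross (deriv u p.1 + p.2 • deriv n p.1) (n p.1) := by
  rw [ContinuousLinearMap.det, ← LinearMap.det_toMatrix (Module.Basis.finTwoProd ℝ),
    Matrix.det_fin_two]
  simp [LinearMap.toMatrix_apply, tubeDeriv, cross]
  ring

theorem continuous_det_tubeDeriv (hu : ContDiff ℝ 1 u) (hn : ContDiff ℝ 1 n) :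
    Continuous fun p => (tubeDeriv u n p).det := by
  have := hu.continuous_deriv le_rfl
  have := hn.continuous_deriv le_rfl
  have := hn.continuous
  simp_rw [det_tubeDeriv]
  exact continuous_cross (by fun_prop) (by fun_prop)

theorem setIntegral_tube_divergence (hu : ContDiff ℝ 1 u) (hn : ContDiff ℝ 1 n)
    {T : ℝ} (hT : 0 < T) (hup : Function.Periodic u T) (hnp : Function.Periodic n T)
    {a b : ℝ} (hab : a ≤ b)
    (hinj : Set.InjOn (tube u n) (Set.Ioc 0 T ×ˢ Set.Ioo a b))
    (hpos : ∀ p ∈ Set.Ioc 0 T ×ˢ Set.Ioo a b, 0 < (tubeDeriv u n p).det)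
    {G : ℝ × ℝ → ℝ × ℝ} (hG : ContDiff ℝ 1 G) :
    ∫ z in tube u n '' (Set.Ioc 0 T ×ˢ Set.Ioo a b), divergence G z =
      ∫ t in (0 : ℝ)..T, (cross (deriv u t + b • deriv n t) (G (tube u n (t, b))) -
        cross (deriv u t + a • deriv n t) (G (tube u n (t, a)))) := by
  have hms : MeasurableSet (Set.Ioc 0 T ×ˢ Set.Ioo a b) := measurableSet_Ioc.prod measurableSet_Ioo
  have hu' := hu.continuous_deriv le_rfl
  have hn' := hn.continuous_deriv le_rfl
  have hnc := hn.continuous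
  have hGc := hG.continuous
  have hG' := hG.continuous_fderiv one_ne_zero
  have hΦ := (contDiff_tube hu hn).continuous
  set A : ℝ × ℝ → ℝ := fun p =>
    cross (fderiv ℝ G (tube u n p) (deriv u p.1 + p.2 • deriv n p.1)) (n p.1) +
      cross (G (tube u n p)) (deriv n p.1) with hA
  set B : ℝ × ℝ → ℝ := fun p =>
    cross (deriv n p.1) (G (tube u n p)) +
      cross (deriv u p.1 + p.2 • deriv n p.1) (fderiv ℝ G (tube u n p) (n p.1)) with hB
  have hAc : Continuous A :=
    (continuous_cross (by fun_prop) (by fun_prop)).add (continuous_cross (by fun_prop) (by fun_prop))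
  have hBc : Continuous B :=
    (continuous_cross (by fun_prop) (by fun_prop)).add (continuous_cross (by fun_prop) (by fun_prop))
  have hint : ∀ {f : ℝ × ℝ → ℝ}, Continuous f →
      IntegrableOn f (Set.Ioc 0 T ×ˢ Set.Ioc a b) := fun hf =>
    (hf.continuousOn.integrableOn_compact (isCompact_Icc.prod isCompact_Icc)).mono_set
      (Set.prod_mono Set.Ioc_subset_Icc_self Set.Ioc_subset_Icc_self)
  have hiter : ∀ {f : ℝ × ℝ → ℝ}, Continuous f →
      ∫ p in Set.Ioc 0 T ×ˢ Set.Ioo a b, f p = ∫ t in (0 : ℝ)..T, ∫ s in a..b, f (t, s) := by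
    intro f hf
    rw [Measure.volume_eq_prod, setIntegral_prod _ ((hint hf).mono_set
      (Set.prod_mono subset_rfl Set.Ioo_subset_Ioc_self)),
      intervalIntegral.integral_of_le hT.le]
    simp_rw [intervalIntegral.integral_of_le hab, integral_Ioc_eq_integral_Ioo]
  have hdA : ∀ t s, HasDerivAt (fun t => cross (G (tube u n (t, s))) (n t)) (A (t, s)) t := by
    intro t s
    have h1 : HasDerivAt (fun t => tube u n (t, s)) (deriv u t + s • deriv n t) t :=
      (hu.differentiable one_ne_zero t).hasDerivAt.add
        ((hn.differentiable one_ne_zero t).hasDerivAt.const_smul s)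
    exact hasDerivAt_cross ((hG.differentiable one_ne_zero _).hasFDerivAt.comp_hasDerivAt t h1)
      (hn.differentiable one_ne_zero t).hasDerivAt
  have hdB : ∀ t s, HasDerivAt (fun s => cross (deriv u t + s • deriv n t) (G (tube u n (t, s))))
      (B (t, s)) s := by
    intro t s
    have h1 : HasDerivAt (fun s => tube u n (t, s)) (n t) s := by
      simpa [tube] using (hasDerivAt_id s).smul_const (n t)
    have h2 : HasDerivAt (fun s : ℝ => deriv u t + s • deriv n t) (deriv n t) s := by
      simpa using (hasDerivAt_id s).smul_const (deriv n t)
    exact hasDerivAt_cross h2 ((hG.differentiable one_ne_zero _).hasFDerivAt.comp_hasDerivAt s h1)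
  rw [integral_image_eq_integral_abs_det_fderiv_smul volume hms
    (fun p _ => (hasFDerivAt_tube hu hn p).hasFDerivWithinAt) hinj]
  have hcongr : ∫ p in Set.Ioc 0 T ×ˢ Set.Ioo a b,
      |(tubeDeriv u n p).det| • divergence G (tube u n p) =
      ∫ p in Set.Ioc 0 T ×ˢ Set.Ioo a b, (A p + B p) := by
    refine setIntegral_congr_fun hms fun p hp => ?_
    have := cross_apply_add_cross_apply (fderiv ℝ G (tube u n p))
      (deriv u p.1 + p.2 • deriv n p.1) (n p.1)
    simp only [abs_of_pos (hpos p hp)]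
    simp only [det_tubeDeriv, smul_eq_mul, divergence, hA, hB]
    rw [mul_comm, ← this]
    simp only [cross]; ring
  rw [hcongr, integral_add ((hint hAc).mono_set (Set.prod_mono subset_rfl Set.Ioo_subset_Ioc_self))
    ((hint hBc).mono_set (Set.prod_mono subset_rfl Set.Ioo_subset_Ioc_self)), hiter hAc, hiter hBc]
  have hAzero : ∫ t in (0 : ℝ)..T, ∫ s in a..b, A (t, s) = 0 := by
    rw [intervalIntegral_intervalIntegral_swap (F := fun t s => A (t, s))]
    · refine (intervalIntegral.integral_congr fun s _ => ?_).trans intervalIntegral.integral_zero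
      rw [intervalIntegral.integral_eq_sub_of_hasDerivAt (fun t _ => hdA t s)
        ((show Continuous fun t => A (t, s) by fun_prop).intervalIntegrable _ _)]
      have h1 := hup 0
      have h2 := hnp 0
      rw [zero_add] at h1 h2
      simp [tube, h1, h2]
    · rw [Set.uIoc_of_le hT.le, Set.uIoc_of_le hab]
      exact hint hAc
  rw [hAzero, zero_add]
  refine intervalIntegral.integral_congr fun t _ => ?_
  exact intervalIntegral.integral_eq_sub_of_hasDerivAt (fun s _ => hdB t s)
    ((show Continuous fun s => B (t, s) by fun_prop).intervalIntegrable _ _)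

end Tube

theorem isPreconnected_subset_or_disjoint {X : Type*} [TopologicalSpace X] {S Ω : Set X}
    (hS : IsPreconnected S) (hΩ : IsOpen Ω) (h : Disjoint S (frontier Ω)) :
    S ⊆ Ω ∨ Disjoint S Ω := by
  have hcover : S ⊆ Ω ∪ (closure Ω)ᶜ := fun z hz => by
    by_cases hzΩ : z ∈ Ω
    · exact Or.inl hzΩ
    · refine Or.inr fun hc => Set.disjoint_left.1 h hz ?_
      rw [hΩ.frontier_eq]; exact ⟨hc, hzΩ⟩
  have hdisj : Disjoint Ω (closure Ω)ᶜ :=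
    Set.disjoint_left.2 fun z hz hz' => hz' (subset_closure hz)
  refine (hS.subset_or_subset hΩ isClosed_closure.isOpen_compl hdisj hcover).imp_right fun h' => ?_
  exact hdisj.symm.mono_left h'

theorem periodic_deriv {u : ℝ → ℝ × ℝ} {T : ℝ} (hu : Function.Periodic u T) :
    Function.Periodic (deriv u) T := fun t => by
  rw [← deriv_comp_add_const]
  exact congrArg (fun f => deriv f t) (funext hu)

section Tubular

variable {u n : ℝ → ℝ × ℝ} {T : ℝ}

theorem tube_sub_zsmul (hup : Function.Periodic u T) (hnp : Function.Periodic n T) (t s : ℝ)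
    (k : ℤ) : tube u n (t - k • T, s) = tube u n (t, s) := by
  simp only [tube, hup.sub_zsmul_eq, hnp.sub_zsmul_eq]

theorem map_nhds_tube (hu : ContDiff ℝ 1 u) (hn : ContDiff ℝ 1 n) {p : ℝ × ℝ}
    (hp : (tubeDeriv u n p).det ≠ 0) : map (tube u n) (𝓝 p) = 𝓝 (tube u n p) := by
  have h := hasStrictFDerivAt_tube hu hn p
  rw [← ContinuousLinearMap.coe_toContinuousLinearEquivOfDetNeZero _ hp] at h
  exact h.map_nhds_eq_of_equiv

theorem eventually_injective_tube (hu : ContDiff ℝ 1 u) (hn : ContDiff ℝ 1 n) {p : ℝ × ℝ}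
    (hp : (tubeDeriv u n p).det ≠ 0) :
    ∀ᶠ q : (ℝ × ℝ) × (ℝ × ℝ) in 𝓝 (p, p), tube u n q.1 = tube u n q.2 → q.1 = q.2 := by
  have h := hasStrictFDerivAt_tube hu hn p
  rw [← ContinuousLinearMap.coe_toContinuousLinearEquivOfDetNeZero _ hp] at h
  have hl := h.eventually_left_inverse
  filter_upwards [hl.prodMk_nhds hl] with q hq heq
  rw [← hq.1, ← hq.2, heq]

theorem exists_tubular_neighborhood (hu : ContDiff ℝ 1 u) (hn : ContDiff ℝ 1 n)
    (hT : 0 < T) (hup : Function.Periodic u T) (hnp : Function.Periodic n T)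
    (hpos : ∀ t, 0 < cross (deriv u t) (n t))
    (hemb : ∀ t s, u t = u s → ∃ k : ℤ, t - s = T * k) :
    ∃ ε > 0, (∀ t s, |s| ≤ ε → 0 < (tubeDeriv u n (t, s)).det) ∧
      ∀ t s t' s', |s| ≤ ε → |s'| ≤ ε → tube u n (t, s) = tube u n (t', s') →
        s = s' ∧ ∃ k : ℤ, t - t' = T * k := by
  have hdet : ∀ t, 0 < (tubeDeriv u n (t, 0)).det := fun t => by
    simpa [det_tubeDeriv] using hpos t
  have hΦ := (contDiff_tube hu hn).continuous
  have h1 : ∀ᶠ s in 𝓝 (0 : ℝ), ∀ t ∈ Set.Icc 0 T, 0 < (tubeDeriv u n (t, s)).det :=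
    isCompact_Icc.eventually_forall_of_forall_eventually fun t _ =>
      ((continuous_det_tubeDeriv hu hn).comp continuous_swap).continuousAt.eventually
        (lt_mem_nhds (hdet t))
  have h2 : ∀ᶠ q : ℝ × ℝ in 𝓝 ((0, 0) : ℝ × ℝ), ∀ r ∈ Set.Icc 0 T ×ˢ Set.Icc 0 T,
      tube u n (r.1, q.1) = tube u n (r.2, q.2) → q.1 = q.2 ∧ ∃ k : ℤ, r.1 - r.2 = T * k := by
    refine (isCompact_Icc.prod isCompact_Icc).eventually_forall_of_forall_eventually
      fun r _ => ?_
    by_cases hr : u r.1 = u r.2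
    · obtain ⟨k, hk⟩ := hemb _ _ hr
      have hinj := eventually_injective_tube hu hn (hdet r.1).ne'
      have hc : Tendsto (fun z : (ℝ × ℝ) × (ℝ × ℝ) =>
          (((z.2.1, z.1.1), (z.2.2 + T * k, z.1.2)) : (ℝ × ℝ) × (ℝ × ℝ))) (𝓝 ((0, 0), r))
          (𝓝 ((r.1, 0), (r.1, 0))) := by
        have : Continuous (fun z : (ℝ × ℝ) × (ℝ × ℝ) =>
          (((z.2.1, z.1.1), (z.2.2 + T * k, z.1.2)) : (ℝ × ℝ) × (ℝ × ℝ))) := by fun_prop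
        convert this.tendsto ((0, 0), r) using 4
        simp only; linarith
      filter_upwards [hc.eventually hinj] with z hz heq
      have hper : tube u n (z.2.2 + T * k, z.1.2) = tube u n (z.2.2, z.1.2) := by
        rw [← tube_sub_zsmul hup hnp (z.2.2 + T * k) z.1.2 k]
        congr 2
        simp only [zsmul_eq_mul]; ring
      have := hz (heq.trans hper.symm)
      simp only [Prod.mk.injEq] at this
      exact ⟨this.2, k, by linarith [this.1]⟩
    · have hc : Continuous fun z : (ℝ × ℝ) × (ℝ × ℝ) =>
          (tube u n (z.2.1, z.1.1), tube u n (z.2.2, z.1.2)) := by fun_prop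
      have hne : ∀ᶠ w : (ℝ × ℝ) × (ℝ × ℝ) in 𝓝 (tube u n (r.1, 0), tube u n (r.2, 0)),
          w.1 ≠ w.2 :=
        (isOpen_ne_fun continuous_fst continuous_snd).mem_nhds (by simpa [tube] using hr)
      filter_upwards [(hc.tendsto ((0, 0), r)).eventually hne] with z hz heq
      exact absurd heq hz
  obtain ⟨δ₁, hδ₁, H1⟩ := Metric.eventually_nhds_iff.1 h1
  obtain ⟨δ₂, hδ₂, H2⟩ := Metric.eventually_nhds_iff.1 h2
  have hmin := lt_min hδ₁ hδ₂
  refine ⟨min δ₁ δ₂ / 2, by positivity, fun t s hs => ?_, fun t s t' s' hs hs' heq => ?_⟩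
  · obtain ⟨k, hk, -⟩ := existsUnique_sub_zsmul_mem_Ico hT t 0
    rw [zero_add] at hk
    have hlt : dist s 0 < δ₁ := by
      rw [Real.dist_0_eq_abs]; linarith [min_le_left δ₁ δ₂]
    have := H1 hlt _ (Set.Ico_subset_Icc_self hk)
    simpa only [det_tubeDeriv, (periodic_deriv hup).sub_zsmul_eq,
      (periodic_deriv hnp).sub_zsmul_eq, hnp.sub_zsmul_eq] using this
  · obtain ⟨k, hk, -⟩ := existsUnique_sub_zsmul_mem_Ico hT t 0
    obtain ⟨k', hk', -⟩ := existsUnique_sub_zsmul_mem_Ico hT t' 0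
    rw [zero_add] at hk hk'
    have hlt : dist (s, s') ((0, 0) : ℝ × ℝ) < δ₂ := by
      rw [Prod.dist_eq, Real.dist_0_eq_abs, Real.dist_0_eq_abs]
      exact max_lt (by linarith [min_le_right δ₁ δ₂]) (by linarith [min_le_right δ₁ δ₂])
    obtain ⟨hss, m, hm⟩ := H2 hlt (t - k • T, t' - k' • T)
      ⟨Set.Ico_subset_Icc_self hk, Set.Ico_subset_Icc_self hk'⟩
      (by simpa only [tube_sub_zsmul hup hnp] using heq)
    refine ⟨hss, m + k - k', ?_⟩
    simp only [zsmul_eq_mul] at hm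
    push_cast
    linarith

theorem contDiff_smul_of_tsupport_subset {φ : ℝ × ℝ → ℝ} {F : ℝ × ℝ → ℝ × ℝ} {U : Set (ℝ × ℝ)}
    (hφ : ContDiff ℝ 1 φ) (hF : ContDiffOn ℝ 1 F U) (hU : IsOpen U) (hs : tsupport φ ⊆ U) :
    ContDiff ℝ 1 fun z => φ z • F z := by
  refine contDiff_iff_contDiffAt.2 fun z => ?_
  by_cases hz : z ∈ tsupport φ
  · exact hφ.contDiffAt.smul (hF.contDiffAt (hU.mem_nhds (hs hz)))
  · refine (contDiffAt_const (c := 0)).congr_of_eventuallyEq ?_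
    filter_upwards [notMem_tsupport_iff_eventuallyEq.1 hz] with w hw
    simp [hw]

theorem divergence_congr {F G : ℝ × ℝ → ℝ × ℝ} {z : ℝ × ℝ} (h : F =ᶠ[𝓝 z] G) :
    divergence F z = divergence G z := by
  simp only [divergence, h.fderiv_eq]

theorem divergence_eq_zero_of_eventuallyEq {F : ℝ × ℝ → ℝ × ℝ} {z : ℝ × ℝ} (h : F =ᶠ[𝓝 z] 0) :
    divergence F z = 0 := by
  rw [divergence_congr h]; simp [divergence]

theorem divergence_add {F G : ℝ × ℝ → ℝ × ℝ} {z : ℝ × ℝ} (hF : DifferentiableAt ℝ F z)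
    (hG : DifferentiableAt ℝ G z) : divergence (F + G) z = divergence F z + divergence G z := by
  simp only [divergence, fderiv_add hF hG, add_apply, Prod.fst_add,
    Prod.snd_add]
  ring

/-- A field supported in a thin strip around the boundary curve has vanishing total divergence
over the domain as soon as its flux through the boundary curve vanishes. -/
theorem setIntegral_divergence_eq_zero_of_tube (hu : ContDiff ℝ 1 u) (hn : ContDiff ℝ 1 n)
    (hT : 0 < T) (hup : Function.Periodic u T) (hnp : Function.Periodic n T) {ε : ℝ} (hε : 0 < ε)
    (hdet : ∀ t s, |s| ≤ ε → 0 < (tubeDeriv u n (t, s)).det)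
    (hinj : ∀ t s t' s', |s| ≤ ε → |s'| ≤ ε → tube u n (t, s) = tube u n (t', s') →
      s = s' ∧ ∃ k : ℤ, t - t' = T * k)
    {Ω : Set (ℝ × ℝ)} (hΩ : IsOpen Ω) (hbd : Set.range u = frontier Ω)
    {G : ℝ × ℝ → ℝ × ℝ} (hG : ContDiff ℝ 1 G) (hGs : HasCompactSupport G)
    (hsupp : tsupport G ⊆ tube u n '' (Set.univ ×ˢ Set.Ioo (-ε) ε))
    (hflux : ∫ t in (0 : ℝ)..T, cross (deriv u t) (G (u t)) = 0) :
    ∫ z in Ω, divergence G z = 0 := by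
  have hend : ∀ t s, |s| = ε → G (tube u n (t, s)) = 0 := by
    intro t s hs
    refine image_eq_zero_of_notMem_tsupport fun hmem => ?_
    obtain ⟨⟨t', s'⟩, ⟨-, hs'⟩, heq⟩ := hsupp hmem
    have habs : |s'| < ε := abs_lt.2 hs'
    have := (hinj _ _ _ _ habs.le hs.le heq).1
    rw [this] at habs
    exact habs.ne hs
  have hmulZ : ∀ {x y : ℝ}, x ∈ Set.Ioc 0 T → y ∈ Set.Ioc 0 T → (∃ k : ℤ, x - y = T * k) →
      x = y := by
    rintro x y hx hy ⟨k, hk⟩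
    have h1 : (k : ℝ) < 1 := by
      by_contra! h; nlinarith [hx.2, hy.1]
    have h2 : (-1 : ℝ) < k := by
      by_contra! h; nlinarith [hx.1, hy.2]
    have : k = 0 := by
      have : k < 1 := by exact_mod_cast h1
      have : -1 < k := by exact_mod_cast h2
      omega
    rw [this] at hk; simp at hk; linarith
  have hside : ∀ {a b : ℝ}, Set.Ioo a b ⊆ Set.Icc (-ε) ε →
      Set.InjOn (tube u n) (Set.Ioc 0 T ×ˢ Set.Ioo a b) := by
    rintro a b hsub ⟨t, s⟩ ⟨ht, hs⟩ ⟨t', s'⟩ ⟨ht', hs'⟩ heq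
    obtain ⟨h1, h2⟩ := hinj _ _ _ _ (abs_le.2 (hsub hs)) (abs_le.2 (hsub hs')) heq
    exact Prod.ext (hmulZ ht ht' h2) h1
  have hmeas : ∀ {a b : ℝ}, Set.Ioo a b ⊆ Set.Icc (-ε) ε →
      MeasurableSet (tube u n '' (Set.Ioc 0 T ×ˢ Set.Ioo a b)) := fun hsub =>
    measurable_image_of_fderivWithin (measurableSet_Ioc.prod measurableSet_Ioo)
      (fun p _ => (hasFDerivAt_tube hu hn p).hasFDerivWithinAt) (hside hsub)
  have hdich : ∀ {a b : ℝ}, Set.Ioo a b ⊆ Set.Icc (-ε) ε → 0 ∉ Set.Ioo a b →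
      tube u n '' (Set.Ioc 0 T ×ˢ Set.Ioo a b) ⊆ Ω ∨
        Disjoint (tube u n '' (Set.Ioc 0 T ×ˢ Set.Ioo a b)) Ω := by
    intro a b hsub h0
    refine isPreconnected_subset_or_disjoint ((isPreconnected_Ioc.prod isPreconnected_Ioo).image _
      (contDiff_tube hu hn).continuous.continuousOn) hΩ (Set.disjoint_left.2 ?_)
    rintro _ ⟨⟨t, s⟩, ⟨-, hs⟩, rfl⟩ hmem
    rw [← hbd] at hmem
    obtain ⟨t', ht'⟩ := hmem
    have := (hinj t s t' 0 (abs_le.2 (hsub hs)) (by simpa using hε.le) (by rw [← ht']; simp [tube])).1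
    exact h0 (this ▸ hs)
  have hflux0 : ∀ {a b : ℝ}, a ≤ b → Set.Ioo a b ⊆ Set.Icc (-ε) ε → 0 ∉ Set.Ioo a b →
      (a = 0 ∧ b = ε ∨ a = -ε ∧ b = 0) →
      ∫ z in Ω ∩ tube u n '' (Set.Ioc 0 T ×ˢ Set.Ioo a b), divergence G z = 0 := by
    intro a b hab hsub h0 hcase
    rcases hdich hsub h0 with h | h
    · rw [Set.inter_eq_right.2 h, setIntegral_tube_divergence hu hn hT hup hnp hab (hside hsub)
        (fun p hp => hdet p.1 p.2 (abs_le.2 (hsub hp.2))) hG]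
      rcases hcase with ⟨rfl, rfl⟩ | ⟨rfl, rfl⟩
      · simp_rw [hend _ b (abs_of_pos hε)]
        rw [← neg_eq_zero, ← intervalIntegral.integral_neg]
        simpa [tube, cross] using hflux
      · simp_rw [hend _ (-ε) (by rw [abs_neg, abs_of_pos hε])]
        simpa [tube, cross] using hflux
    · rw [Set.inter_comm, h.inter_eq]; simp
  have hsubp : Set.Ioo 0 ε ⊆ Set.Icc (-ε) ε := fun x hx => ⟨by linarith [hx.1], hx.2.le⟩
  have hsubm : Set.Ioo (-ε) 0 ⊆ Set.Icc (-ε) ε := fun x hx => ⟨hx.1.le, by linarith [hx.2]⟩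
  have hneg : -ε ≤ 0 := by linarith
  set P := tube u n '' (Set.Ioc 0 T ×ˢ Set.Ioo 0 ε)
  set M := tube u n '' (Set.Ioc 0 T ×ˢ Set.Ioo (-ε) 0)
  have hzero : ∀ z ∈ Ω \ (Ω ∩ (P ∪ M)), divergence G z = 0 := by
    rintro z ⟨hzΩ, hz⟩
    by_cases hzs : z ∈ tsupport G
    · exfalso
      obtain ⟨⟨t, s⟩, ⟨-, hs⟩, heq⟩ := hsupp hzs
      obtain ⟨k, hk, -⟩ := existsUnique_sub_zsmul_mem_Ioc hT t 0
      rw [zero_add] at hk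
      rw [← tube_sub_zsmul hup hnp t s k] at heq
      rcases lt_trichotomy s 0 with h | h | h
      · exact hz ⟨hzΩ, Or.inr ⟨(t - k • T, s), ⟨hk, hs.1, h⟩, heq⟩⟩
      · have : z ∈ frontier Ω := by
          rw [← hbd, ← heq, h]; exact ⟨t - k • T, by simp [tube]⟩
        exact (Set.disjoint_left.1 (disjoint_frontier_iff_isOpen.2 hΩ) this) hzΩ
      · exact hz ⟨hzΩ, Or.inl ⟨(t - k • T, s), ⟨hk, h, hs.2⟩, heq⟩⟩
    · exact divergence_eq_zero_of_eventuallyEq (notMem_tsupport_iff_eventuallyEq.1 hzs)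
  have hPm : MeasurableSet P := hmeas hsubp
  have hMm : MeasurableSet M := hmeas hsubm
  have hPM : Disjoint P M := by
    refine Set.disjoint_left.2 ?_
    rintro _ ⟨⟨t, s⟩, ⟨-, hs⟩, rfl⟩ ⟨⟨t', s'⟩, ⟨-, hs'⟩, heq⟩
    have := (hinj _ _ _ _ (abs_le.2 (hsubm hs')) (abs_le.2 (hsubp hs)) heq).1
    have h1 := hs.1
    have h2 := hs'.2
    simp only at h1 h2
    linarith
  have hi : Integrable (divergence G) :=
    (continuous_divergence hG).integrable_of_hasCompactSupport (hasCompactSupport_divergence hGs)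
  rw [setIntegral_eq_of_subset_of_forall_sdiff_eq_zero hΩ.measurableSet Set.inter_subset_left
    hzero, Set.inter_union_distrib_left, setIntegral_union
    (hPM.mono Set.inter_subset_right Set.inter_subset_right) (hΩ.measurableSet.inter hMm)
    hi.integrableOn hi.integrableOn,
    hflux0 hε.le hsubp (by simp) (Or.inl ⟨rfl, rfl⟩),
    hflux0 hneg hsubm (by simp) (Or.inr ⟨rfl, rfl⟩), add_zero]

/-- The divergence theorem, in the case of zero flux, on a bounded open set whose boundary is a
regular closed embedded curve. -/
theorem setIntegral_divergence_eq_zero (hu : ContDiff ℝ 1 u) (hn : ContDiff ℝ 1 n)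
    (hT : 0 < T) (hup : Function.Periodic u T) (hnp : Function.Periodic n T)
    (hpos : ∀ t, 0 < cross (deriv u t) (n t))
    (hemb : ∀ t s, u t = u s → ∃ k : ℤ, t - s = T * k)
    {Ω U : Set (ℝ × ℝ)} (hΩ : IsOpen Ω) (hΩb : Bornology.IsBounded Ω)
    (hbd : Set.range u = frontier Ω) (hU : IsOpen U) (hΩU : closure Ω ⊆ U)
    {F : ℝ × ℝ → ℝ × ℝ} (hF : ContDiffOn ℝ 1 F U)
    (hflux : ∫ t in (0 : ℝ)..T, cross (deriv u t) (F (u t)) = 0) :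
    ∫ z in Ω, divergence F z = 0 := by
  obtain ⟨ε, hε, hdet, hinj⟩ := exists_tubular_neighborhood hu hn hT hup hnp hpos hemb
  have hcl : IsCompact (closure Ω) := hΩb.isCompact_closure
  have hfr : IsCompact (frontier Ω) := hcl.of_isClosed_subset isClosed_frontier
    frontier_subset_closure
  have hfrV : frontier Ω ⊆ interior (tube u n '' (Set.univ ×ˢ Set.Ioo (-ε) ε)) ∩ U := by
    refine fun z hz => ⟨?_, hΩU (frontier_subset_closure hz)⟩
    rw [← hbd] at hz
    obtain ⟨t, rfl⟩ := hz
    rw [mem_interior_iff_mem_nhds]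
    have h0 : tube u n (t, 0) = u t := by simp [tube]
    rw [← h0, ← map_nhds_tube hu hn (hdet t 0 (by simpa using hε.le)).ne']
    exact image_mem_map (prod_mem_nhds univ_mem (Ioo_mem_nhds (by linarith) hε))
  obtain ⟨C, hC, hCi, hCV⟩ := exists_compact_between hfr (isOpen_interior.inter hU) hfrV
  obtain ⟨φ, hφ1, hφ0, -⟩ := exists_contMDiffMap_one_nhds_of_subset_interior
    (n := 1) (modelWithCornersSelf ℝ (ℝ × ℝ)) isClosed_frontier hCi
  have hφ : ContDiff ℝ 1 φ := φ.contMDiff.contDiff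
  have hφC : tsupport φ ⊆ C :=
    closure_minimal (fun z hz => by_contra fun h => hz (hφ0 z h)) hC.isClosed
  set G : ℝ × ℝ → ℝ × ℝ := fun z => φ z • F z
  set H : ℝ × ℝ → ℝ × ℝ := Ω.indicator fun z => (1 - φ z) • F z
  have hG : ContDiff ℝ 1 G :=
    contDiff_smul_of_tsupport_subset hφ hF hU (hφC.trans (hCV.trans Set.inter_subset_right))
  have hGC : tsupport G ⊆ C := (tsupport_smul_subset_left _ _).trans hφC
  have hGs : HasCompactSupport G := hC.of_isClosed_subset (isClosed_tsupport _) hGC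
  have hHzero : ∀ z ∉ Ω, H =ᶠ[𝓝 z] 0 := by
    intro z hz
    by_cases hzc : z ∈ closure Ω
    · have hzf : z ∈ frontier Ω := by rw [hΩ.frontier_eq]; exact ⟨hzc, hz⟩
      filter_upwards [(eventually_nhdsSet_iff_forall.1 hφ1) z hzf] with w hw
      simp [H, Set.indicator, hw]
    · filter_upwards [isClosed_closure.isOpen_compl.mem_nhds hzc] with w hw
      exact Set.indicator_of_notMem (fun h => hw (subset_closure h)) _
  have hH : ContDiff ℝ 1 H := by
    refine contDiff_iff_contDiffAt.2 fun z => ?_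
    by_cases hz : z ∈ Ω
    · have hzU := hF.contDiffAt (hU.mem_nhds (hΩU (subset_closure hz)))
      have h1 : ContDiffAt ℝ 1 (fun z => (1 - φ z) • F z) z :=
        (contDiffAt_const.sub hφ.contDiffAt).smul hzU
      refine h1.congr_of_eventuallyEq ?_
      filter_upwards [hΩ.mem_nhds hz] with w hw
      exact Set.indicator_of_mem hw _
    · exact (contDiffAt_const (c := 0)).congr_of_eventuallyEq (hHzero z hz)
  have hHs : HasCompactSupport H := HasCompactSupport.intro hcl fun z hz =>
    Set.indicator_of_notMem (fun h => hz (subset_closure h)) _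
  have hsplit : ∀ z ∈ Ω, divergence F z = divergence G z + divergence H z := by
    intro z hz
    rw [← divergence_add (hG.differentiable one_ne_zero z) (hH.differentiable one_ne_zero z)]
    refine divergence_congr ?_
    filter_upwards [hΩ.mem_nhds hz] with w hw
    simp only [G, H, Pi.add_apply, Set.indicator_of_mem hw, ← add_smul]
    simp
  have hi : ∀ {f : ℝ × ℝ → ℝ × ℝ}, ContDiff ℝ 1 f → HasCompactSupport f →
      IntegrableOn (divergence f) Ω := fun hf hs =>
    ((continuous_divergence hf).integrable_of_hasCompactSupport
      (hasCompactSupport_divergence hs)).integrableOn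
  rw [setIntegral_congr_fun hΩ.measurableSet hsplit, integral_add (hi hG hGs) (hi hH hHs),
    setIntegral_eq_integral_of_forall_compl_eq_zero
      (fun z hz => divergence_eq_zero_of_eventuallyEq (hHzero z hz)),
    integral_divergence_eq_zero hH hHs, add_zero]
  refine setIntegral_divergence_eq_zero_of_tube hu hn hT hup hnp hε hdet hinj hΩ hbd hG hGs
    (hGC.trans (hCV.trans (Set.inter_subset_left.trans interior_subset))) ?_
  refine Eq.trans ?_ hflux
  refine intervalIntegral.integral_congr fun t _ => ?_
  have : φ (u t) = 1 := (eventually_nhdsSet_iff_forall.1 hφ1 (u t)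
    (hbd ▸ Set.mem_range_self t)).self_of_nhds
  simp only [G, this, one_smul]

end Tubular

/-- The Killing field `z ↦ a + b z + c z²` of the hyperbolic plane, in real coordinates. -/
def killing (a b c : ℝ) (z : ℝ × ℝ) : ℝ × ℝ :=
  (a + b * z.1 + c * (z.1 ^ 2 - z.2 ^ 2), b * z.2 + c * (2 * z.1 * z.2))

theorem hasFDerivAt_killing (a b c : ℝ) (z : ℝ × ℝ) :
    HasFDerivAt (killing a b c)
      (((b + 2 * c * z.1) • ContinuousLinearMap.fst ℝ ℝ ℝ -
          (2 * c * z.2) • ContinuousLinearMap.snd ℝ ℝ ℝ).prod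
        ((2 * c * z.2) • ContinuousLinearMap.fst ℝ ℝ ℝ +
          (b + 2 * c * z.1) • ContinuousLinearMap.snd ℝ ℝ ℝ)) z := by
  have h1 : HasFDerivAt (fun z : ℝ × ℝ => z.1) _ z := hasFDerivAt_fst (𝕜 := ℝ)
  have h2 : HasFDerivAt (fun z : ℝ × ℝ => z.2) _ z := hasFDerivAt_snd (𝕜 := ℝ)
  have h3 := (((h1.const_mul b).const_add a).add
    (((h1.pow 2).sub (h2.pow 2)).const_mul c)).prodMk
    ((h2.const_mul b).add (((h1.const_mul 2).mul h2).const_mul c))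
  refine h3.congr_fderiv ?_
  ext <;> simp <;> ring

theorem contDiff_killing (a b c : ℝ) : ContDiff ℝ 1 (killing a b c) := by
  unfold killing; fun_prop

theorem isOpen_upperHalfPlane : IsOpen {z : ℝ × ℝ | 0 < z.2} :=
  isOpen_lt continuous_const continuous_snd

theorem divergence_mul_killing {K : ℝ × ℝ → ℝ} {z : ℝ × ℝ} (hz : 0 < z.2)
    (hK : DifferentiableAt ℝ K z) (a b c : ℝ) :
    divergence (fun z => (K z / z.2 ^ 2) • killing a b c z) z =
      fderiv ℝ K z (killing a b c z) / z.2 ^ 2 := by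
  have h2 : HasFDerivAt (fun z : ℝ × ℝ => z.2) _ z := hasFDerivAt_snd (𝕜 := ℝ)
  have hz0 : z.2 ^ 2 ≠ 0 := by positivity
  have hinv := (hasDerivAt_inv hz0).comp_hasFDerivAt z (h2.pow 2)
  have h := (hK.hasFDerivAt.mul hinv).smul (hasFDerivAt_killing a b c z)
  have hKz : fderiv ℝ K z (killing a b c z) =
      (killing a b c z).1 * fderiv ℝ K z (1, 0) + (killing a b c z).2 * fderiv ℝ K z (0, 1) := by
    rw [← smul_eq_mul, ← smul_eq_mul, ← map_smul, ← map_smul, ← map_add]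
    simp
  simp only [div_eq_mul_inv]
  rw [divergence, HasFDerivAt.fderiv (f := fun z : ℝ × ℝ => (K z * (z.2 ^ 2)⁻¹) • killing a b c z) h,
    hKz]
  simp [killing]
  field_simp
  ring

section KLoop

variable {K : ℝ × ℝ → ℝ} {u : ℝ → ℝ × ℝ}

theorem IsKLoop.contDiff_deriv (hu : IsKLoop K u) : ContDiff ℝ 1 (deriv u) :=
  (contDiff_succ_iff_deriv (n := 1).1 hu.1).2.2

theorem IsKLoop.hasDerivAt (hu : IsKLoop K u) (t : ℝ) : HasDerivAt u (deriv u t) t :=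
  (hu.1.differentiable two_ne_zero t).hasDerivAt

theorem IsKLoop.hasDerivAt_deriv (hu : IsKLoop K u) (t : ℝ) :
    HasDerivAt (deriv u)
      ((u t).2⁻¹ • Gam (deriv u t) + (hypL u * K (u t)) • rot (deriv u t)) t := by
  have h := (hu.contDiff_deriv.differentiable one_ne_zero t).hasDerivAt
  rwa [sub_eq_iff_eq_add'.1 (hu.2.2.2.2 t)] at h

theorem IsKLoop.speed_eq (hu : IsKLoop K u) (t s : ℝ) :
    ((deriv u t).1 ^ 2 + (deriv u t).2 ^ 2) / (u t).2 ^ 2 =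
      ((deriv u s).1 ^ 2 + (deriv u s).2 ^ 2) / (u s).2 ^ 2 := by
  have hd : ∀ t, HasDerivAt
      (fun t => ((deriv u t).1 ^ 2 + (deriv u t).2 ^ 2) / (u t).2 ^ 2) 0 t := by
    intro t
    have hpos := hu.2.2.1 t
    have h1 := hu.hasDerivAt_deriv t
    have h := ((h1.fst_comp.pow 2).add (h1.snd_comp.pow 2)).div
      ((hu.hasDerivAt t).snd_comp.pow 2) (pow_ne_zero 2 hpos.ne')
    refine h.congr_deriv ?_
    simp [Gam, rot]
    field_simp
    ring_nf
    simp
  exact is_const_of_deriv_eq_zero (fun t => (hd t).differentiableAt) (fun t => (hd t).deriv) t s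

theorem IsKLoop.deriv_ne_zero (hu : IsKLoop K u) (t : ℝ) :
    0 < (deriv u t).1 ^ 2 + (deriv u t).2 ^ 2 := by
  by_contra hle
  have hzero : (deriv u t).1 ^ 2 + (deriv u t).2 ^ 2 = 0 :=
    le_antisymm (not_lt.1 hle) (by positivity)
  have hall : ∀ s, deriv u s = 0 := by
    intro s
    have h := hu.speed_eq s t
    have hpos := hu.2.2.1 s
    rw [hzero, zero_div, div_eq_zero_iff, or_iff_left (by positivity)] at h
    ext
    · simp only [Prod.fst_zero]; nlinarith [sq_nonneg (deriv u s).1, sq_nonneg (deriv u s).2]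
    · simp only [Prod.snd_zero]; nlinarith [sq_nonneg (deriv u s).1, sq_nonneg (deriv u s).2]
  exact hu.2.2.2.1 ⟨u 0, fun s =>
    is_const_of_deriv_eq_zero (hu.1.differentiable two_ne_zero) hall s 0⟩

theorem IsKLoop.hypL_pos (hu : IsKLoop K u) : 0 < hypL u := by
  have hpos := hu.2.2.1 0
  have hd := hu.deriv_ne_zero 0
  rw [hypL, intervalIntegral.integral_congr fun t _ => hu.speed_eq t 0]
  have := Real.pi_pos
  simp only [intervalIntegral.integral_const, sub_zero, smul_eq_mul]
  positivity

/-- Conservation law along a `K`-loop attached to a Killing field. -/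
theorem IsKLoop.integral_cross_killing (hK : ContinuousOn K {z : ℝ × ℝ | 0 < z.2})
    (hu : IsKLoop K u) (a b c : ℝ) :
    ∫ t in (0 : ℝ)..(2 * π),
      cross (deriv u t) ((K (u t) / (u t).2 ^ 2) • killing a b c (u t)) = 0 := by
  have hd : ∀ t, HasDerivAt
      (fun t => dotp (killing a b c (u t)) (deriv u t) / (u t).2 ^ 2)
      (hypL u * cross (deriv u t) ((K (u t) / (u t).2 ^ 2) • killing a b c (u t))) t := by
    intro t
    have hpos := hu.2.2.1 t
    have h0 := hu.hasDerivAt t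
    have h1 := hu.hasDerivAt_deriv t
    have hX := (hasFDerivAt_killing a b c (u t)).comp_hasDerivAt t h0
    have h := ((hX.fst_comp.mul h1.fst_comp).add (hX.snd_comp.mul h1.snd_comp)).div
      (h0.snd_comp.pow 2) (pow_ne_zero 2 hpos.ne')
    refine h.congr_deriv ?_
    simp [Gam, rot, cross, killing]
    field_simp
    ring
  have hc : Continuous fun t =>
      hypL u * cross (deriv u t) ((K (u t) / (u t).2 ^ 2) • killing a b c (u t)) := by
    have huc := hu.1.continuous
    have hX := (contDiff_killing a b c).continuous
    have hKu : Continuous fun t => K (u t) := hK.comp_continuous huc hu.2.2.1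
    refine continuous_const.mul (continuous_cross hu.contDiff_deriv.continuous
      (Continuous.smul (hKu.div (by fun_prop) fun t => ?_) (by fun_prop)))
    exact pow_ne_zero 2 (hu.2.2.1 t).ne'
  have h := intervalIntegral.integral_eq_sub_of_hasDerivAt (fun t _ => hd t)
    (hc.intervalIntegrable 0 (2 * π))
  have hu0 := hu.2.1 0
  have hu1 := periodic_deriv hu.2.1 0
  rw [zero_add] at hu0 hu1
  rw [hu0, hu1, sub_self, intervalIntegral.integral_const_mul] at h
  exact (mul_eq_zero.1 h).resolve_left hu.hypL_pos.ne'

theorem IsKLoop.setIntegral_killing_eq_zero (hK : ContDiffOn ℝ 1 K {z : ℝ × ℝ | 0 < z.2})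
    {Ω : Set (ℝ × ℝ)} (hΩo : IsOpen Ω) (hΩb : Bornology.IsBounded Ω)
    (hΩH : Ω ⊆ {z : ℝ × ℝ | 0 < z.2}) (hu : IsKLoop K u) (hemb : IsEmbedded u)
    (hbd : Set.range u = frontier Ω) (a b c : ℝ) :
    ∫ z in Ω, fderiv ℝ K z (killing a b c z) / z.2 ^ 2 = 0 := by
  have hH := isOpen_upperHalfPlane
  have hcl : closure Ω ⊆ {z : ℝ × ℝ | 0 < z.2} := by
    rw [closure_eq_self_union_frontier, ← hbd]
    exact Set.union_subset hΩH (Set.range_subset_iff.2 hu.2.2.1)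
  have hF : ContDiffOn ℝ 1 (fun z : ℝ × ℝ => (K z / z.2 ^ 2) • killing a b c z)
      {z : ℝ × ℝ | 0 < z.2} :=
    (hK.div (by fun_prop) fun z hz => pow_ne_zero 2 (ne_of_gt hz)).smul
      (contDiff_killing a b c).contDiffOn
  have hdu := hu.contDiff_deriv
  have hn : ContDiff ℝ 1 fun t => rot (deriv u t) := by
    unfold rot; fun_prop
  rw [← setIntegral_divergence_eq_zero (hu.1.of_le one_le_two) hn Real.two_pi_pos hu.2.1
    (fun t => congrArg rot (periodic_deriv hu.2.1 t))
    (fun t => by simpa [cross, rot, sq] using hu.deriv_ne_zero t) hemb hΩo hΩb hbd hH hcl hF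
    (hu.integral_cross_killing hK.continuousOn a b c)]
  refine setIntegral_congr_fun hΩo.measurableSet fun z hz => (divergence_mul_killing (hΩH hz)
    ((hK.differentiableOn one_ne_zero).differentiableAt (hH.mem_nhds (hΩH hz))) a b c).symm

end KLoop

/-- if the boundary of a bounded open domain `Ω ⊂ H²` is parameterized by an
embedded `K`-loop, then the integrals over `Ω` of `∇K·e₁`, `∇K·z` and `∇K·z²` against the
hyperbolic volume element `z₂⁻² dz` all vanish. -/
theorem stmt_1 (K : (ℝ × ℝ) → ℝ)
    (hK : ContDiffOn ℝ 1 K {z : ℝ × ℝ | 0 < z.2})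
    (Ω : Set (ℝ × ℝ)) (hΩo : IsOpen Ω) (hΩb : Bornology.IsBounded Ω)
    (hΩH : Ω ⊆ {z : ℝ × ℝ | 0 < z.2})
    (u : ℝ → ℝ × ℝ) (hu : IsKLoop K u) (hemb : IsEmbedded u)
    (hbd : Set.range u = frontier Ω) :
    (∫ z in Ω, fderiv ℝ K z ((1:ℝ), (0:ℝ)) / z.2 ^ 2) = 0 ∧
    (∫ z in Ω, fderiv ℝ K z z / z.2 ^ 2) = 0 ∧
    (∫ z in Ω, fderiv ℝ K z (z.1 ^ 2 - z.2 ^ 2, 2 * z.1 * z.2) / z.2 ^ 2) = 0 := by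
  have h := hu.setIntegral_killing_eq_zero hK hΩo hΩb hΩH hemb hbd
  refine ⟨?_, ?_, ?_⟩
  · simpa [killing] using h 1 0 0
  · simpa [killing] using h 0 1 0
  · simpa [killing] using h 0 0 1
end
end

section
/- Let k>1 and let u : ℝ → H² be a nonconstant C² 2π-periodic solution of u'' − u₂⁻¹Γ(u') = L(u) k iu'. Then μ := L(u)/R_k is a positive integer, and there exist t₀ ∈ ℝ and z=(z₁,z₂) ∈ H² such that u(t) = (z₁ + z₂ω₁(μt+t₀), z₂ω₂(μt+t₀)) for all t ∈ ℝ. In particular u parameterizes the hyperbolic circle of center z and hyperbolic radius ρ_k, and L(u) = μR_k. -/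
open Real MeasureTheory Filter Topology

noncomputable section

/-- `R_k = (k² - 1)^{-1/2}`. -/
def Rk (k : ℝ) : ℝ := 1 / Real.sqrt (k ^ 2 - 1)

/-- The reference loop `ω(t) = (cos t, 1/R_k) / (k - sin t)`, a parameterization of the
hyperbolic circle of center `(0,1)` and hyperbolic radius `ρ_k = artanh(1/k)`. -/
def om (k : ℝ) (t : ℝ) : ℝ × ℝ := (cos t / (k - sin t), (1 / Rk k) / (k - sin t))

theorem exists_eq_const_of_hasDerivAt_zero {f : ℝ → ℝ} (hf : ∀ t, HasDerivAt f 0 t) :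
    ∃ C, ∀ t, f t = C :=
  ⟨f 0, fun t => is_const_of_deriv_eq_zero (fun s => (hf s).differentiableAt)
    (fun s => (hf s).deriv) t 0⟩

/-- Solutions of the harmonic oscillator `w'' = -m² w` in amplitude-phase form; the amplitude `r`
is determined by the energy. -/
theorem exists_phase_of_harmonic {m r : ℝ} (hm : 0 < m) (hr : 0 ≤ r) {w w' : ℝ → ℝ}
    (hw : ∀ t, HasDerivAt w (w' t) t) (hw' : ∀ t, HasDerivAt w' (-m ^ 2 * w t) t)
    (hE : (w' 0) ^ 2 + m ^ 2 * (w 0) ^ 2 = m ^ 2 * r ^ 2) :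
    ∃ t₀, ∀ t, w t = -r * sin (m * t + t₀) := by
  have hlin : ∀ t, HasDerivAt (fun s : ℝ => m * s) m t := fun t => by
    simpa using (hasDerivAt_id t).const_mul m
  obtain ⟨a, ha⟩ := exists_eq_const_of_hasDerivAt_zero
    (f := fun t => m * w t * cos (m * t) - w' t * sin (m * t)) fun t => by
      refine ((((hw t).const_mul m).mul (hlin t).cos).sub
        ((hw' t).mul (hlin t).sin)).congr_deriv ?_
      ring
  obtain ⟨b, hb⟩ := exists_eq_const_of_hasDerivAt_zero
    (f := fun t => m * w t * sin (m * t) + w' t * cos (m * t)) fun t => by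
      refine ((((hw t).const_mul m).mul (hlin t).sin).add
        ((hw' t).mul (hlin t).cos)).congr_deriv ?_
      ring
  have ha0 : m * w 0 = a := by simpa using ha 0
  have hb0 : w' 0 = b := by simpa using hb 0
  have hnorm : ‖(⟨-b, -a⟩ : ℂ)‖ = m * r := by
    rw [Complex.norm_eq_sqrt_sq_add_sq, Real.sqrt_eq_iff_mul_self_eq (by positivity)
      (by positivity)]
    simp only
    rw [← ha0, ← hb0]
    linarith
  have hcos := Complex.norm_mul_cos_arg (⟨-b, -a⟩ : ℂ)
  have hsin := Complex.norm_mul_sin_arg (⟨-b, -a⟩ : ℂ)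
  rw [hnorm] at hcos hsin
  refine ⟨Complex.arg ⟨-b, -a⟩, fun t => mul_left_cancel₀ hm.ne' ?_⟩
  rw [sin_add]
  linear_combination (-m * w t) * sin_sq_add_cos_sq (m * t) + cos (m * t) * ha t
    + sin (m * t) * hb t + sin (m * t) * hcos + cos (m * t) * hsin

/-- The constant-curvature system in the half-plane, in coordinates `(x, y)` with velocity `(p, q)`
and hyperbolic speed `c`, has the circles `ω_z(mt + t₀)`, `m = c √(k² - 1)`, as its solutions. -/
theorem exists_circle_of_curvature_eq {k c : ℝ} (hk : 1 < k) (hc : 0 < c) {x y p q : ℝ → ℝ}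
    (hy : ∀ t, 0 < y t) (hx' : ∀ t, HasDerivAt x (p t) t) (hy' : ∀ t, HasDerivAt y (q t) t)
    (hp' : ∀ t, HasDerivAt p (2 * p t * q t / y t - c * k * q t) t)
    (hq' : ∀ t, HasDerivAt q ((q t ^ 2 - p t ^ 2) / y t + c * k * p t) t)
    (hE : ∀ t, p t ^ 2 + q t ^ 2 = c ^ 2 * y t ^ 2) :
    ∃ t₀ z₁ z₂ : ℝ, 0 < z₂ ∧ ∀ t,
      x t = z₁ + z₂ * (om k (c * √(k ^ 2 - 1) * t + t₀)).1 ∧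
      y t = z₂ * (om k (c * √(k ^ 2 - 1) * t + t₀)).2 := by
  have hk1 : 0 < k ^ 2 - 1 := by nlinarith
  set s := √(k ^ 2 - 1) with hs
  have hs0 : 0 < s := Real.sqrt_pos.2 hk1
  have hs2 : s ^ 2 = k ^ 2 - 1 := Real.sq_sqrt hk1.le
  obtain ⟨A, hA⟩ := exists_eq_const_of_hasDerivAt_zero
    (f := fun t => c * k * (y t)⁻¹ - p t * ((y t)⁻¹) ^ 2) fun t => by
      have hyt := (hy t).ne'
      have hi := (hy' t).inv hyt
      refine ((hi.const_mul (c * k)).sub ((hp' t).mul (hi.pow 2))).congr_deriv ?_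
      simp
      field_simp
      ring
  -- `B = k A / (c s²)` is the mean value of `1 / y`.
  set B := k * A / (c * s ^ 2) with hB
  have hBA : B * (c * s ^ 2) = k * A := by rw [hB]; field_simp
  have hv : ∀ t, HasDerivAt (fun t => (y t)⁻¹ - B) (-q t * ((y t)⁻¹) ^ 2) t := fun t => by
    refine (((hy' t).inv (hy t).ne').sub_const B).congr_deriv ?_
    field_simp
  have hv' : ∀ t, HasDerivAt (fun t => -q t * ((y t)⁻¹) ^ 2)
      (-(c * s) ^ 2 * ((y t)⁻¹ - B)) t := fun t => by
    have hyt := (hy t).ne'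
    refine ((hq' t).neg.mul (((hy' t).inv hyt).pow 2)).congr_deriv ?_
    have hAt := hA t
    have hi : y t * (y t)⁻¹ = 1 := mul_inv_cancel₀ hyt
    simp only [Pi.pow_apply, Pi.inv_apply, Pi.neg_apply, div_eq_mul_inv, ← inv_pow]
    push_cast
    generalize (y t)⁻¹ = i at *
    linear_combination i ^ 3 * hE t + c * k * hAt - c * hBA + c ^ 2 * i * hs2
      + c ^ 2 * i * (y t * i + 1) * hi
  have hen : (-q 0 * ((y 0)⁻¹) ^ 2) ^ 2 + (c * s) ^ 2 * ((y 0)⁻¹ - B) ^ 2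
      = (c * s) ^ 2 * (|A| / (c * s ^ 2)) ^ 2 := by
    have hi : y 0 * (y 0)⁻¹ = 1 := mul_inv_cancel₀ (hy 0).ne'
    have hA0 := hA 0
    have hj : A / (c * s ^ 2) * (c * s ^ 2) = A := by field_simp
    have hBj : B = k * (A / (c * s ^ 2)) := by rw [hB]; ring
    rw [div_pow, sq_abs, ← div_pow, hBj]
    generalize A / (c * s ^ 2) = j at *
    generalize (y 0)⁻¹ = i at *
    have hpi : p 0 * i ^ 2 = c * k * i - j * (c * s ^ 2) := by linarith
    have hq : q 0 ^ 2 * i ^ 4 = c ^ 2 * i ^ 2 - (c * k * i - j * (c * s ^ 2)) ^ 2 := by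
      rw [← hpi]
      linear_combination i ^ 4 * hE 0 + c ^ 2 * i ^ 2 * (y 0 * i + 1) * hi
    linear_combination hq + (c ^ 2 * i ^ 2 - c ^ 2 * s ^ 2 * j ^ 2) * hs2
  obtain ⟨t₀, ht₀⟩ := exists_phase_of_harmonic (m := c * s) (by positivity)
    (by positivity) hv hv' hen
  have hBpos : 0 < B := by
    have h := ht₀ (-t₀ / (c * s))
    have e : c * s * (-t₀ / (c * s)) + t₀ = 0 := by field_simp; ring
    rw [e, sin_zero] at h
    have := inv_pos.2 (hy (-t₀ / (c * s)))
    linarith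
  have hApos : 0 < A := by
    have : 0 < k * A := by rw [← hBA]; positivity
    exact pos_of_mul_pos_right this (by linarith)
  rw [abs_of_pos hApos] at ht₀
  have hD : ∀ θ, 0 < k - sin θ := fun θ => by linarith [sin_le_one θ]
  have hyform : ∀ t, y t = c * s / A * (s / (k - sin (c * s * t + t₀))) := fun t => by
    have h := ht₀ t
    have hDt := hD (c * s * t + t₀)
    have hyt := (hy t).ne'
    rw [hB] at h
    field_simp at h ⊢
    linarith
  have hxconst := exists_eq_const_of_hasDerivAt_zero
    (f := fun t => x t - c * s / A * (cos (c * s * t + t₀) / (k - sin (c * s * t + t₀))))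
    fun t => by
      have hDt := hD (c * s * t + t₀)
      have hlin : HasDerivAt (fun t : ℝ => c * s * t + t₀) (c * s) t := by
        simpa using ((hasDerivAt_id t).const_mul (c * s)).add_const t₀
      refine ((hx' t).sub (((hlin.cos).div ((hlin.sin).const_sub k) hDt.ne').const_mul
        (c * s / A))).congr_deriv ?_
      have hpt : p t = c * k * y t - A * y t ^ 2 := by
        have := hA t
        have hyt := (hy t).ne'
        field_simp at this
        linarith
      rw [hpt, hyform t]
      have h1 := sin_sq_add_cos_sq (c * s * t + t₀)
      generalize sin (c * s * t + t₀) = S at *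
      generalize cos (c * s * t + t₀) = C at *
      field_simp
      linear_combination -c ^ 2 * s ^ 2 * h1 - c ^ 2 * s ^ 2 * hs2
  obtain ⟨z₁, hz₁⟩ := hxconst
  refine ⟨t₀, z₁, c * s / A, by positivity, fun t => ⟨?_, ?_⟩⟩
  · have := hz₁ t
    simp only [om]
    linarith
  · rw [hyform t]
    simp only [om, Rk, one_div_one_div, ← hs]

/-- classification of nonconstant `2π`-periodic solutions of the
constant-curvature-`k` loop equation: any such solution is `ω_z(μt + t₀)` for some
positive integer `μ`, phase `t₀`, and center `z ∈ H²`; in particular `L(u) = μ R_k`. -/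
theorem stmt_4 (k : ℝ) (hk : 1 < k) (u : ℝ → ℝ × ℝ)
    (hu : IsKLoop (fun _ => k) u) :
    ∃ μ : ℕ, 0 < μ ∧ hypL u = (μ : ℝ) * Rk k ∧
      ∃ t₀ : ℝ, ∃ z : ℝ × ℝ, 0 < z.2 ∧
        ∀ t : ℝ, u t = (z.1 + z.2 * (om k ((μ : ℝ) * t + t₀)).1,
                        z.2 * (om k ((μ : ℝ) * t + t₀)).2) := by
  obtain ⟨hC, hper, hpos, hnc, heq⟩ := hu
  have hd0 : ∀ t, HasDerivAt u (deriv u t) t := fun t =>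
    (hC.differentiable (by norm_num) t).hasDerivAt
  have hd1 : ∀ t, HasDerivAt (deriv u) (deriv (deriv u) t) t := fun t =>
    (((contDiff_succ_iff_deriv (n := 1)).1 hC).2.2.differentiable (by norm_num) t).hasDerivAt
  set c := hypL u with hc
  have hx' : ∀ t, HasDerivAt (fun t => (u t).1) (deriv u t).1 t := fun t => (hd0 t).fst
  have hy' : ∀ t, HasDerivAt (fun t => (u t).2) (deriv u t).2 t := fun t => (hd0 t).snd
  have hp' : ∀ t, HasDerivAt (fun t => (deriv u t).1)
      (2 * (deriv u t).1 * (deriv u t).2 / (u t).2 - c * k * (deriv u t).2) t := fun t => by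
    refine HasDerivAt.congr_deriv (hd1 t).fst ?_
    have := congrArg Prod.fst (heq t)
    simp [Gam, rot] at this
    linear_combination this
  have hq' : ∀ t, HasDerivAt (fun t => (deriv u t).2)
      (((deriv u t).2 ^ 2 - (deriv u t).1 ^ 2) / (u t).2 + c * k * (deriv u t).1) t := fun t => by
    refine HasDerivAt.congr_deriv (hd1 t).snd ?_
    have := congrArg Prod.snd (heq t)
    simp [Gam, rot] at this
    linear_combination this
  obtain ⟨E, hE⟩ := exists_eq_const_of_hasDerivAt_zero
    (f := fun t => ((deriv u t).1 ^ 2 + (deriv u t).2 ^ 2) / (u t).2 ^ 2) fun t => by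
      have hyt := (hpos t).ne'
      refine ((((hp' t).pow 2).add ((hq' t).pow 2)).div ((hy' t).pow 2)
        (pow_ne_zero 2 hyt)).congr_deriv ?_
      simp only [Pi.pow_apply, Pi.add_apply]
      field_simp
      ring
  have hE0 : 0 ≤ E := by rw [← hE 0]; positivity
  have hcE : c ^ 2 = E := by
    have : c = √E := by
      rw [hc, hypL]
      simp only [hE]
      simp
      congr 1
      field_simp
    rw [this, Real.sq_sqrt hE0]
  have hspeed : ∀ t, (deriv u t).1 ^ 2 + (deriv u t).2 ^ 2 = c ^ 2 * (u t).2 ^ 2 := fun t => by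
    rw [hcE, ← hE t]
    have hyt := (hpos t).ne'
    field_simp
  have hc0 : 0 < c := by
    refine lt_of_le_of_ne (Real.sqrt_nonneg _) fun h => hnc ⟨u 0, fun t => ?_⟩
    refine is_const_of_deriv_eq_zero (fun s => (hd0 s).differentiableAt) (fun s => ?_) t 0
    have := hspeed s
    rw [← h] at this
    ext
    · simp; nlinarith
    · simp; nlinarith
  obtain ⟨t₀, z₁, z₂, hz₂, hform⟩ :=
    exists_circle_of_curvature_eq hk hc0 hpos hx' hy' hp' hq' hspeed
  have hs0 : 0 < √(k ^ 2 - 1) := Real.sqrt_pos.2 (by nlinarith)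
  set m := c * √(k ^ 2 - 1) with hm
  have hm0 : 0 < m := by positivity
  have hcos : cos (2 * π * m) = 1 := by
    have h := congrArg Prod.snd (hper ((π / 2 - t₀) / m))
    rw [(hform _).2, (hform _).2] at h
    have e1 : m * ((π / 2 - t₀) / m) + t₀ = π / 2 := by field_simp; ring
    have e2 : m * ((π / 2 - t₀) / m + 2 * π) + t₀ = 2 * π * m + π / 2 := by field_simp; ring
    rw [e1, e2] at h
    simp only [om, Rk, one_div_one_div, sin_add_pi_div_two, sin_pi_div_two] at h
    have h1 : 0 < k - cos (2 * π * m) := by linarith [cos_le_one (2 * π * m)]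
    have h2 : 0 < k - 1 := by linarith
    field_simp at h
    linarith
  obtain ⟨n, hn⟩ := (cos_eq_one_iff _).1 hcos
  have hnm : (n : ℝ) = m := by
    have := pi_pos
    have h : (2 * π) * (n : ℝ) = (2 * π) * m := by linarith
    exact mul_left_cancel₀ (by positivity) h
  have hn0 : 0 < n := by
    rw [← hnm] at hm0
    exact_mod_cast hm0
  lift n to ℕ using hn0.le
  have hnm' : (n : ℝ) = m := by exact_mod_cast hnm
  refine ⟨n, by exact_mod_cast hn0, ?_, t₀, (z₁, z₂), hz₂, fun t => ?_⟩
  · rw [hnm', hm, Rk]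
    field_simp
  · rw [hnm']
    exact Prod.ext (hform t).1 (hform t).2
end
end

section
/- For every nonconstant C² 2π-periodic curve u : ℝ → H² the following four integral identities hold: ∫₀^{2π} u₂⁻²(−u'' + u₂⁻¹Γ(u'))·(1,0) dt = 0; ∫₀^{2π} u₂⁻²(−u'' + u₂⁻¹Γ(u'))·u dt = 0; ∫₀^{2π} u₂⁻²(−u'' + u₂⁻¹Γ(u'))·(u₁²−u₂², 2u₁u₂) dt = 0; and ∫₀^{2π} u₂⁻²(−u'' + u₂⁻¹Γ(u'))·u' dt = 0. -/
open Real MeasureTheory Filter Topology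

noncomputable section

theorem integral_eq_zero_of_periodic_primitive {F f : ℝ → ℝ} {T : ℝ}
    (hF : Function.Periodic F T) (hderiv : ∀ t, HasDerivAt F (f t) t) (hf : Continuous f) :
    ∫ t in (0:ℝ)..T, f t = 0 := by
  rw [intervalIntegral.integral_eq_sub_of_hasDerivAt (fun t _ => hderiv t)
    (hf.intervalIntegrable _ _), hF.eq, sub_self]

theorem Function.Periodic.deriv_periodic {E : Type*} [NormedAddCommGroup E] [NormedSpace ℝ E]
    {u : ℝ → E} {T : ℝ} (hu : Function.Periodic u T) : Function.Periodic (deriv u) T := by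
  intro t
  rw [← deriv_comp_add_const, funext hu]

theorem HasDerivAt.fst_coord {v : ℝ → ℝ × ℝ} {v' : ℝ × ℝ} {t : ℝ} (hv : HasDerivAt v v' t) :
    HasDerivAt (fun s => (v s).1) v'.1 t := by
  simpa using (HasFDerivAt.fst hv.hasFDerivAt).hasDerivAt

theorem HasDerivAt.snd_coord {v : ℝ → ℝ × ℝ} {v' : ℝ × ℝ} {t : ℝ} (hv : HasDerivAt v v' t) :
    HasDerivAt (fun s => (v s).2) v'.2 t := by
  simpa using (HasFDerivAt.snd hv.hasFDerivAt).hasDerivAt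

theorem HasDerivAt.dotp {v w : ℝ → ℝ × ℝ} {v' w' : ℝ × ℝ} {t : ℝ}
    (hv : HasDerivAt v v' t) (hw : HasDerivAt w w' t) :
    HasDerivAt (fun s => _root_.dotp (v s) (w s))
      (_root_.dotp v' (w t) + _root_.dotp (v t) w') t := by
  have h := (hv.fst_coord.mul hw.fst_coord).add (hv.snd_coord.mul hw.snd_coord)
  refine h.congr_deriv ?_
  simp only [_root_.dotp]
  ring

theorem continuous_dotp_tension {u V : ℝ → ℝ × ℝ} (hu : ContDiff ℝ 2 u)
    (hpos : ∀ t, 0 < (u t).2) (hV : Continuous V) :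
    Continuous fun t => dotp (-(deriv (deriv u) t) + ((u t).2)⁻¹ • Gam (deriv u t)) (V t)
      / (u t).2 ^ 2 := by
  have hu₀ : Continuous u := hu.continuous
  have hu₁ : ContDiff ℝ 1 (deriv u) := ContDiff.deriv' hu
  have hu₁c : Continuous (deriv u) := hu₁.continuous
  have hu₂ : Continuous (deriv (deriv u)) := hu₁.continuous_deriv le_rfl
  have hne : ∀ t, (u t).2 ≠ 0 := fun t => (hpos t).ne'
  have hne' : ∀ t, (u t).2 ^ 2 ≠ 0 := fun t => pow_ne_zero 2 (hne t)
  simp only [dotp, Gam]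
  fun_prop (disch := assumption)

/-- A field `V` along `u` with derivative `V'`, satisfying the Killing equation in the direction
`u'`, is orthogonal in the mean to the tension field of `u`. -/
theorem integral_dotp_tension_eq_zero {u V V' : ℝ → ℝ × ℝ} {T : ℝ} (hu : ContDiff ℝ 2 u)
    (hper : Function.Periodic u T) (hpos : ∀ t, 0 < (u t).2) (hVper : Function.Periodic V T)
    (hV : ∀ t, HasDerivAt V (V' t) t)
    (hkilling : ∀ t, dotp (Gam (deriv u t)) (V t) =
      2 * (deriv u t).2 * dotp (deriv u t) (V t) - (u t).2 * dotp (deriv u t) (V' t)) :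
    ∫ t in (0:ℝ)..T, dotp (-(deriv (deriv u) t) + ((u t).2)⁻¹ • Gam (deriv u t)) (V t)
      / (u t).2 ^ 2 = 0 := by
  have hd (t) : HasDerivAt u (deriv u t) t := (hu.differentiable (by norm_num) t).hasDerivAt
  have hu₁ : ContDiff ℝ 1 (deriv u) := ContDiff.deriv' hu
  have hdd (t) : HasDerivAt (deriv u) (deriv (deriv u) t) t :=
    (hu₁.differentiable (by norm_num) t).hasDerivAt
  refine integral_eq_zero_of_periodic_primitive
    (F := fun t => -(dotp (deriv u t) (V t) / (u t).2 ^ 2)) ?_ (fun t => ?_)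
    (continuous_dotp_tension hu hpos (continuous_iff_continuousAt.2 fun t => (hV t).continuousAt))
  · intro t
    simp only [hper t, hVper t, hper.deriv_periodic t]
  · have hne := (hpos t).ne'
    refine (((hdd t).dotp (hV t)).div ((hd t).snd_coord.pow 2) (pow_ne_zero 2 hne)).neg.congr_deriv ?_
    have hk := hkilling t
    simp only [dotp, Prod.fst_add, Prod.snd_add, Prod.fst_neg, Prod.snd_neg, Prod.smul_fst,
      Prod.smul_snd, smul_eq_mul, Pi.pow_apply] at hk ⊢
    field_simp
    push_cast
    linear_combination -(u t).2 * hk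

/-- The tension field of `u` is orthogonal in the mean to the velocity `u'`. -/
theorem integral_dotp_tension_deriv_eq_zero {u : ℝ → ℝ × ℝ} {T : ℝ} (hu : ContDiff ℝ 2 u)
    (hper : Function.Periodic u T) (hpos : ∀ t, 0 < (u t).2) :
    ∫ t in (0:ℝ)..T, dotp (-(deriv (deriv u) t) + ((u t).2)⁻¹ • Gam (deriv u t)) (deriv u t)
      / (u t).2 ^ 2 = 0 := by
  have hd (t) : HasDerivAt u (deriv u t) t := (hu.differentiable (by norm_num) t).hasDerivAt
  have hu₁ : ContDiff ℝ 1 (deriv u) := ContDiff.deriv' hu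
  have hdd (t) : HasDerivAt (deriv u) (deriv (deriv u) t) t :=
    (hu₁.differentiable (by norm_num) t).hasDerivAt
  refine integral_eq_zero_of_periodic_primitive
    (F := fun t => -(dotp (deriv u t) (deriv u t) / (u t).2 ^ 2) / 2) ?_ (fun t => ?_)
    (continuous_dotp_tension hu hpos hu₁.continuous)
  · intro t
    simp only [hper t, hper.deriv_periodic t]
  · have hne := (hpos t).ne'
    refine ((((hdd t).dotp (hdd t)).div ((hd t).snd_coord.pow 2)
      (pow_ne_zero 2 hne)).neg.div_const 2).congr_deriv ?_
    simp only [dotp, Gam, Prod.fst_add, Prod.snd_add, Prod.fst_neg, Prod.snd_neg, Prod.smul_fst,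
      Prod.smul_snd, smul_eq_mul, Pi.pow_apply]
    field_simp
    push_cast
    ring

/-- the four integral identities expressing the invariance of the
hyperbolic length functional under the isometry group of `H²` and parameter rotations. -/
theorem stmt_6 (u : ℝ → ℝ × ℝ) (hu : ContDiff ℝ 2 u)
    (hper : Function.Periodic u (2 * π)) (hpos : ∀ t, 0 < (u t).2)
    (hnc : ¬ ∃ c, ∀ t, u t = c) :
    (∫ t in (0:ℝ)..(2 * π),
      dotp (-(deriv (deriv u) t) + ((u t).2)⁻¹ • Gam (deriv u t)) ((1:ℝ), (0:ℝ))
        / (u t).2 ^ 2) = 0 ∧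
    (∫ t in (0:ℝ)..(2 * π),
      dotp (-(deriv (deriv u) t) + ((u t).2)⁻¹ • Gam (deriv u t)) (u t)
        / (u t).2 ^ 2) = 0 ∧
    (∫ t in (0:ℝ)..(2 * π),
      dotp (-(deriv (deriv u) t) + ((u t).2)⁻¹ • Gam (deriv u t))
          ((u t).1 ^ 2 - (u t).2 ^ 2, 2 * (u t).1 * (u t).2)
        / (u t).2 ^ 2) = 0 ∧
    (∫ t in (0:ℝ)..(2 * π),
      dotp (-(deriv (deriv u) t) + ((u t).2)⁻¹ • Gam (deriv u t)) (deriv u t)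
        / (u t).2 ^ 2) = 0 := by
  have hd (t) : HasDerivAt u (deriv u t) t := (hu.differentiable (by norm_num) t).hasDerivAt
  refine ⟨?_, ?_, ?_, integral_dotp_tension_deriv_eq_zero hu hper hpos⟩
  · refine integral_dotp_tension_eq_zero (V := fun _ => (1, 0)) hu hper hpos (fun _ => rfl)
      (fun t => hasDerivAt_const t _) fun t => ?_
    simp only [dotp, Gam, Prod.fst_zero, Prod.snd_zero]
    ring
  · refine integral_dotp_tension_eq_zero hu hper hpos hper hd fun t => ?_
    simp only [dotp, Gam]
    ring
  · refine integral_dotp_tension_eq_zero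
      (V := fun t => ((u t).1 ^ 2 - (u t).2 ^ 2, 2 * (u t).1 * (u t).2)) hu hper hpos
      (fun t => by simp only [hper t])
      (fun t => (((hd t).fst_coord.pow 2).sub ((hd t).snd_coord.pow 2)).prodMk
        (((hd t).fst_coord.const_mul 2).mul (hd t).snd_coord)) fun t => ?_
    simp only [dotp, Gam]
    push_cast
    ring
end
end

section
/- For every C² 2π-periodic function g=(g₁,g₂) : ℝ → ℝ², setting φ = g₁ω' + g₂ iω', one has the identity 𝓙(φ) = (Bg)₁ ω' + (Bg)₂ iω' pointwise on ℝ. -/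
open Real MeasureTheory Filter Topology

noncomputable section

/-- The differential `Γ'(w)v = 2(v₂ w - v₁ iw)`. -/
def Gam' (w v : ℝ × ℝ) : ℝ × ℝ := (2 * v.2) • w - (2 * v.1) • rot w

/-- The operator `𝓙`, equal to `ω₂²` times the linearization at `ω` of the
constant-curvature-`k` loop equation:
`𝓙(φ) = -φ'' + kR_k iφ' + ω₂⁻¹Γ'(ω')φ' - ω₂⁻²φ₂Γ(ω') - k²(⨍ ω₂⁻²φ·iω') iω'`. -/
def Jop (k : ℝ) (φ : ℝ → ℝ × ℝ) (t : ℝ) : ℝ × ℝ :=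
  -(deriv (deriv φ) t) + (k * Rk k) • rot (deriv φ t)
    + ((om k t).2)⁻¹ • Gam' (deriv (om k) t) (deriv φ t)
    - ((φ t).2 / (om k t).2 ^ 2) • Gam (deriv (om k) t)
    - (k ^ 2 * ((1 / (2 * π)) * ∫ s in (0:ℝ)..(2 * π),
        dotp (φ s) (rot (deriv (om k) s)) / (om k s).2 ^ 2)) • rot (deriv (om k) t)

/-- The operator `B g = -g'' - kR_k ig' + R_k²(g₂ - k² ⨍ g₂) e₂`. -/
def Bop (k : ℝ) (g : ℝ → ℝ × ℝ) (t : ℝ) : ℝ × ℝ :=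
  -(deriv (deriv g) t) - (k * Rk k) • rot (deriv g t)
    + (Rk k ^ 2 * ((g t).2 - k ^ 2 * ((1 / (2 * π)) * ∫ s in (0:ℝ)..(2 * π), (g s).2)))
        • ((0:ℝ), (1:ℝ))

lemma sub_sin_pos {k : ℝ} (hk : 1 < k) (t : ℝ) : 0 < k - sin t := by
  linarith [sin_le_one t]

lemma Rk_pos {k : ℝ} (hk : 1 < k) : 0 < Rk k :=
  one_div_pos.2 (Real.sqrt_pos.2 (by nlinarith))

lemma Rk_sq_mul {k : ℝ} (hk : 1 < k) : Rk k ^ 2 * (k ^ 2 - 1) = 1 := by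
  have h : 0 < k ^ 2 - 1 := by nlinarith
  rw [Rk, div_pow, Real.sq_sqrt h.le]
  field_simp

lemma om_snd_pos {k : ℝ} (hk : 1 < k) (t : ℝ) : 0 < (om k t).2 :=
  div_pos (one_div_pos.2 (Rk_pos hk)) (sub_sin_pos hk t)

/-- The reference loop parameterizes the Euclidean circle of center `(0, k R_k)` and
radius `R_k`. -/
lemma om_mem_circle {k : ℝ} (hk : 1 < k) (t : ℝ) :
    (om k t).1 ^ 2 + (k * Rk k - (om k t).2) ^ 2 = Rk k ^ 2 := by
  have hD := (sub_sin_pos hk t).ne'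
  have hR := (Rk_pos hk).ne'
  simp only [om]
  field_simp
  linear_combination Rk k ^ 2 * sin_sq_add_cos_sq t
    + (Rk k ^ 2 * (k - sin t) ^ 2 - 1) * Rk_sq_mul hk

/-- The reference loop solves the first order system `ω₁' = ω₂ (k R_k - ω₂)`,
`ω₂' = ω₁ ω₂`. -/
lemma hasDerivAt_om {k : ℝ} (hk : 1 < k) (t : ℝ) :
    HasDerivAt (om k) ((om k t).2 * (k * Rk k - (om k t).2), (om k t).1 * (om k t).2) t := by
  have hD := (sub_sin_pos hk t).ne'
  have hR := (Rk_pos hk).ne'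
  have hd : HasDerivAt (fun s => k - sin s) (-cos t) t := (hasDerivAt_sin t).const_sub k
  refine HasDerivAt.prodMk (((hasDerivAt_cos t).div hd hD).congr_deriv ?_)
    (((hasDerivAt_const t (1 / Rk k)).div hd hD).congr_deriv ?_)
  · simp only [om]
    field_simp
    linear_combination Rk k ^ 2 * sin_sq_add_cos_sq t - Rk_sq_mul hk
  · simp only [om]
    field_simp
    ring

lemma deriv_om {k : ℝ} (hk : 1 < k) : deriv (om k) = fun t =>
    ((om k t).2 * (k * Rk k - (om k t).2), (om k t).1 * (om k t).2) :=
  funext fun t => (hasDerivAt_om hk t).deriv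

lemma hasDerivAt_fst {f : ℝ → ℝ × ℝ} {f' : ℝ × ℝ} {t : ℝ} (hf : HasDerivAt f f' t) :
    HasDerivAt (fun s => (f s).1) f'.1 t :=
  (ContinuousLinearMap.fst ℝ ℝ ℝ).hasFDerivAt.comp_hasDerivAt t hf

lemma hasDerivAt_snd {f : ℝ → ℝ × ℝ} {f' : ℝ × ℝ} {t : ℝ} (hf : HasDerivAt f f' t) :
    HasDerivAt (fun s => (f s).2) f'.2 t :=
  (ContinuousLinearMap.snd ℝ ℝ ℝ).hasFDerivAt.comp_hasDerivAt t hf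

/-- The product rule in the moving frame `(ω', iω')`, based on
`ω'' = ω₁ ω' + ω₂ iω'`. -/
lemma hasDerivAt_frame {k : ℝ} (hk : 1 < k) {x y : ℝ → ℝ} {x' y' t : ℝ}
    (hx : HasDerivAt x x' t) (hy : HasDerivAt y y' t) :
    HasDerivAt (fun s => x s • deriv (om k) s + y s • rot (deriv (om k) s))
      ((x' + (om k t).1 * x t - (om k t).2 * y t) • deriv (om k) t
        + (y' + (om k t).1 * y t + (om k t).2 * x t) • rot (deriv (om k) t)) t := by
  have h₁ := hasDerivAt_fst (hasDerivAt_om hk t)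
  have h₂ := hasDerivAt_snd (hasDerivAt_om hk t)
  have hv := h₂.fun_mul (h₂.const_sub (k * Rk k))
  have hw := h₁.fun_mul h₂
  rw [deriv_om hk]
  refine (((hx.fun_mul hv).fun_sub (hy.fun_mul hw)).prodMk
    ((hx.fun_mul hw).fun_add (hy.fun_mul hv))).congr_deriv ?_ |>.congr_of_eventuallyEq
      (.of_forall fun s => ?_)
  · ext <;> simp [rot] <;> ring
  · ext
    · simp [rot]; ring
    · simp [rot]

/-- The weighted normal component of `φ = g₁ω' + g₂ iω'` is `R_k² g₂`. -/
lemma dotp_frame_rot {k : ℝ} (hk : 1 < k) (x y t : ℝ) :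
    dotp (x • deriv (om k) t + y • rot (deriv (om k) t)) (rot (deriv (om k) t))
      / (om k t).2 ^ 2 = Rk k ^ 2 * y := by
  rw [div_eq_iff (pow_ne_zero 2 (om_snd_pos hk t).ne'), ← om_mem_circle hk t, deriv_om hk]
  simp [dotp, rot]
  ring

/-- the functional change `φ = g₁ω' + g₂ iω'` intertwines `𝓙` and `B`:
`𝓙(φ) = (Bg)₁ ω' + (Bg)₂ iω'`. -/
theorem stmt_7 (k : ℝ) (hk : 1 < k) (g : ℝ → ℝ × ℝ)
    (hg : ContDiff ℝ 2 g) (hper : Function.Periodic g (2 * π)) :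
    ∀ t : ℝ,
      Jop k (fun s => (g s).1 • deriv (om k) s + (g s).2 • rot (deriv (om k) s)) t
        = (Bop k g t).1 • deriv (om k) t + (Bop k g t).2 • rot (deriv (om k) t) := by
  intro t
  have hg₁ (s : ℝ) : HasDerivAt g (deriv g s) s :=
    (hg.differentiable (by norm_num) s).hasDerivAt
  have hg₂ : HasDerivAt (deriv g) (deriv (deriv g) t) t :=
    (hg.differentiable_deriv_two t).hasDerivAt
  have hφ := funext fun s =>
    (hasDerivAt_frame hk (hasDerivAt_fst (hg₁ s)) (hasDerivAt_snd (hg₁ s))).deriv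
  have ho₁ := hasDerivAt_fst (hasDerivAt_om hk t)
  have ho₂ := hasDerivAt_snd (hasDerivAt_om hk t)
  have hφ' := (hasDerivAt_frame hk
    (((hasDerivAt_fst hg₂).fun_add (ho₁.fun_mul (hasDerivAt_fst (hg₁ t)))).fun_sub
      (ho₂.fun_mul (hasDerivAt_snd (hg₁ t))))
    (((hasDerivAt_snd hg₂).fun_add (ho₁.fun_mul (hasDerivAt_snd (hg₁ t)))).fun_add
      (ho₂.fun_mul (hasDerivAt_fst (hg₁ t))))).deriv
  have hy := (om_snd_pos hk t).ne'
  have hcircle := om_mem_circle hk t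
  simp only [Jop, Bop, dotp_frame_rot hk, intervalIntegral.integral_const_mul, hφ, hφ',
    (hasDerivAt_om hk t).deriv]
  clear hφ hφ' ho₁ ho₂
  generalize (∫ s in (0:ℝ)..(2 * π), (g s).2) = I, 1 / (2 * π) = P
  generalize deriv (deriv g) t = e, deriv g t = d, g t = c, om k t = o at *
  ext
  · simp [rot, Gam, Gam']
    field_simp
    linear_combination -c.2 * o.1 * hcircle
  · simp [rot, Gam, Gam']
    field_simp
    linear_combination c.2 * (k * Rk k - o.2) * hcircle
end
end
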